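/- arXiv:0812.3667 — 8 statements merged into one kernel-verified Lean document; each statement's English description precedes it below -/
import Mathlib

section
/- Let p_I, p_X, p_Y, p_Z be nonnegative reals summing to 1, and let ρ be the Bell-diagonal two-qubit state ρ = p_I |Φ⁺⟩⟨Φ⁺| + p_Z |Φ⁻⟩⟨Φ⁻| + p_X |Ψ⁺⟩⟨Ψ⁺| + p_Y |Ψ⁻⟩⟨Ψ⁻|, where |Φ^±⟩ = (|00⟩ ± |11⟩)/√2 and |Ψ^±⟩ = (|01⟩ ± |10⟩)/√2. Then ρ admits a symmetric extension if and only if 4·√(p_I·p_X·p_Y·p_Z) ≥ (p_I² + p_X² + p_Y² + p_Z²) − 1/2; equivalently, tr(ρ_B²) ≥ tr(ρ²) − 4√(det ρ). -/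
open Matrix Kronecker ComplexOrder

noncomputable section

/-- `σ` is a symmetric extension of the bipartite state `ρ`:
`σ` is PSD, has trace 1, its partial trace over the third factor is `ρ`,
and it is invariant under swapping the two `B` factors. -/
def IsSymExt {A B : Type*} [Fintype A] [DecidableEq A] [Fintype B] [DecidableEq B]
    (ρ : Matrix (A × B) (A × B) ℂ)
    (σ : Matrix (A × B × B) (A × B × B) ℂ) : Prop :=
  σ.PosSemidef ∧ σ.trace = 1 ∧
  (∀ a a' b b', ∑ c, σ (a, b, c) (a', b', c) = ρ (a, b) (a', b')) ∧
  (∀ a b₁ b₂ a' b₁' b₂', σ (a, b₁, b₂) (a', b₁', b₂') = σ (a, b₂, b₁) (a', b₂', b₁'))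

/-- The reduced state on the second factor. -/
def reduceB {A B : Type*} [Fintype A] (ρ : Matrix (A × B) (A × B) ℂ) : Matrix B B ℂ :=
  fun b b' => ∑ a, ρ (a, b) (a, b')

/-- The multiset of nonzero eigenvalues (with algebraic multiplicity). -/
def nonzeroSpec {n : Type*} [Fintype n] [DecidableEq n] (M : Matrix n n ℂ) : Multiset ℂ :=
  M.charpoly.roots.filter (· ≠ 0)

/-- The largest (real) eigenvalue of a matrix. -/
def lamMax {n : Type*} [Fintype n] [DecidableEq n] (M : Matrix n n ℂ) : ℝ :=
  sSup {x : ℝ | (x : ℂ) ∈ spectrum ℂ M}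

/-- `ρ` admits a pure (rank-one) symmetric extension. -/
def PureExt {A B : Type*} [Fintype A] [DecidableEq A] [Fintype B] [DecidableEq B]
    (ρ : Matrix (A × B) (A × B) ℂ) : Prop :=
  ∃ σ : Matrix (A × B × B) (A × B × B) ℂ, IsSymExt ρ σ ∧ σ.rank = 1

/-- The Bell vectors `Φ⁺, Φ⁻, Ψ⁺, Ψ⁻`, scaled by `√2` and read as `2 × 2` matrices. -/
def bellMatrix : Fin 4 → Matrix (Fin 2) (Fin 2) ℂ :=
  ![!![1, 0; 0, 1], !![1, 0; 0, -1], !![0, 1; 1, 0], !![0, 1; -1, 0]]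

/-- Column `k` is the (scaled) `i`-th term in the expansion of `|k⟩ ⊗ |singlet⟩` in the Bell basis
of the first two qubits. -/
def teleportMatrix (i : Fin 4) : Matrix (Fin 2 × Fin 2 × Fin 2) (Fin 2) ℂ :=
  fun x k => bellMatrix i x.1 x.2.1 *
    (bellMatrix i * (!![0, 1; -1, 0] : Matrix (Fin 2) (Fin 2) ℂ)) k x.2.2

/-- The exchange of the last two tensor factors on indices. -/
def swapRight {A B : Type*} : A × B × B → A × B × B := fun x => (x.1, x.2.2, x.2.1)

lemma teleportMatrix_add_swap_eq_zero :
    teleportMatrix 0 + teleportMatrix 1 + (teleportMatrix 2).submatrix swapRight id +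
      (teleportMatrix 3).submatrix swapRight id = 0 := by
  ext ⟨a, b, c⟩ k
  fin_cases a <;> fin_cases b <;> fin_cases c <;> fin_cases k <;>
    simp [teleportMatrix, swapRight, bellMatrix, Matrix.mul_apply]

/-- The Bell-diagonal state with weights `p` on `Φ⁺, Φ⁻, Ψ⁺, Ψ⁻`. -/
def bellDiagonal (p : Fin 4 → ℝ) : Matrix (Fin 2 × Fin 2) (Fin 2 × Fin 2) ℂ :=
  fun x y => ∑ i, (p i : ℂ) / 2 * (bellMatrix i x.1 x.2 * bellMatrix i y.1 y.2)

lemma trace_teleportMatrix_sandwich {p : Fin 4 → ℝ}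
    {σ : Matrix (Fin 2 × Fin 2 × Fin 2) (Fin 2 × Fin 2 × Fin 2) ℂ}
    (h : IsSymExt (bellDiagonal p) σ) (i : Fin 4) :
    ((teleportMatrix i)ᴴ * σ * teleportMatrix i).trace = 2 * p i := by
  have hm := h.2.2.1
  simp only [bellDiagonal, Fin.sum_univ_four, Fin.sum_univ_two] at hm
  have h00 := hm 0 0 0 0
  have h03 := hm 0 1 0 1
  have h30 := hm 1 0 1 0
  have h33 := hm 1 1 1 1
  have h11 := hm 0 0 1 1
  have h12 := hm 0 1 1 0
  have h21 := hm 1 0 0 1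
  have h22 := hm 1 1 0 0
  fin_cases i <;>
    simp [teleportMatrix, bellMatrix, Matrix.trace, Matrix.mul_apply, Fintype.sum_prod_type] at *
  · linear_combination h00 + h03 + h30 + h33
  · linear_combination h00 - h03 - h30 + h33
  · linear_combination h11 + h12 + h21 + h22
  · linear_combination h11 - h12 - h21 + h22

lemma IsSymExt.submatrix_swapRight {A B : Type*} [Fintype A] [DecidableEq A] [Fintype B]
    [DecidableEq B] {ρ : Matrix (A × B) (A × B) ℂ} {σ : Matrix (A × B × B) (A × B × B) ℂ}
    (h : IsSymExt ρ σ) : σ.submatrix swapRight swapRight = σ := by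
  ext ⟨a, b, c⟩ ⟨a', b', c'⟩
  exact (h.2.2.2 a b c a' b' c').symm

lemma swapRight_involutive {A B : Type*} : Function.Involutive (swapRight (A := A) (B := B)) :=
  fun _ => rfl

lemma IsSymExt.sandwich_submatrix_swapRight {A B n : Type*} [Fintype A] [DecidableEq A]
    [Fintype B] [DecidableEq B] {ρ : Matrix (A × B) (A × B) ℂ}
    {σ : Matrix (A × B × B) (A × B × B) ℂ} (h : IsSymExt ρ σ) (E : Matrix (A × B × B) n ℂ) :
    (E.submatrix swapRight id)ᴴ * σ * E.submatrix swapRight id = Eᴴ * σ * E := by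
  nth_rewrite 1 [← h.submatrix_swapRight]
  rw [Matrix.conjTranspose_submatrix,
    Matrix.submatrix_mul _ _ _ _ _ swapRight_involutive.bijective |>.symm,
    Matrix.submatrix_mul _ _ _ _ _ swapRight_involutive.bijective |>.symm, Matrix.submatrix_id_id]

open scoped MatrixOrder Matrix.Norms.L2Operator in
lemma exists_eq_conjTranspose_mul_self {n : Type*} [Fintype n] [DecidableEq n]
    {M : Matrix n n ℂ} (hM : M.PosSemidef) : ∃ B : Matrix n n ℂ, M = Bᴴ * B :=
  CStarAlgebra.nonneg_iff_eq_star_mul_self.mp hM.nonneg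

section FrobeniusNorm

open scoped Matrix.Norms.Frobenius

lemma frobenius_norm_eq_sqrt_trace {m n : Type*} [Fintype m] [Fintype n] (Y : Matrix m n ℂ) :
    ‖Y‖ = √((Yᴴ * Y).trace.re) := by
  rw [Matrix.frobenius_norm_def, ← Real.sqrt_eq_rpow, Finset.sum_comm]
  simp [Matrix.trace, Matrix.mul_apply, ← Complex.normSq_eq_conj_mul_self,
    ← Complex.normSq_eq_norm_sq, -Complex.ofReal_pow]

/-- The four numbers `√(p i)` satisfy the polygon inequality. -/
lemma IsSymExt.sqrt_le_sum_sqrt {p : Fin 4 → ℝ}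
    {σ : Matrix (Fin 2 × Fin 2 × Fin 2) (Fin 2 × Fin 2 × Fin 2) ℂ}
    (h : IsSymExt (bellDiagonal p) σ) (i : Fin 4) : 2 * √(p i) ≤ ∑ j, √(p j) := by
  obtain ⟨B, hB⟩ := exists_eq_conjTranspose_mul_self h.1
  have norm_eq (i) : ‖B * teleportMatrix i‖ = √2 * √(p i) := by
    rw [frobenius_norm_eq_sqrt_trace, ← Real.sqrt_mul zero_le_two, Matrix.conjTranspose_mul,
      Matrix.mul_assoc, ← Matrix.mul_assoc Bᴴ, ← hB, ← Matrix.mul_assoc,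
      trace_teleportMatrix_sandwich h]
    norm_cast
  have norm_swap (i) : ‖B * (teleportMatrix i).submatrix swapRight id‖ = √2 * √(p i) := by
    rw [← norm_eq, frobenius_norm_eq_sqrt_trace, frobenius_norm_eq_sqrt_trace]
    simp only [Matrix.conjTranspose_mul, Matrix.mul_assoc, ← Matrix.mul_assoc Bᴴ, ← hB]
    simp only [← Matrix.mul_assoc, h.sandwich_submatrix_swapRight]
  have hsum := congrArg (B * ·) teleportMatrix_add_swap_eq_zero
  simp only [Matrix.mul_add, Matrix.mul_zero] at hsum
  have n0 := norm_eq 0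
  have n1 := norm_eq 1
  have n2 := norm_swap 2
  have n3 := norm_swap 3
  have le_of_sum_eq_zero {a b c d : Matrix (Fin 2 × Fin 2 × Fin 2) (Fin 2) ℂ}
      (habcd : a + b + c + d = 0) : ‖a‖ ≤ ‖b‖ + ‖c‖ + ‖d‖ := by
    rw [← norm_neg a, show -a = b + c + d by rw [neg_eq_iff_add_eq_zero, ← habcd]; abel]
    exact norm_add₃_le
  rw [Fin.sum_univ_four]
  generalize B * teleportMatrix 0 = Y0, B * teleportMatrix 1 = Y1,
    B * (teleportMatrix 2).submatrix swapRight id = Y2,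
    B * (teleportMatrix 3).submatrix swapRight id = Y3 at *
  have i0 := le_of_sum_eq_zero hsum
  have i1 : ‖Y1‖ ≤ ‖Y0‖ + ‖Y2‖ + ‖Y3‖ := le_of_sum_eq_zero (by rw [← hsum]; abel)
  have i2 : ‖Y2‖ ≤ ‖Y0‖ + ‖Y1‖ + ‖Y3‖ := le_of_sum_eq_zero (by rw [← hsum]; abel)
  have i3 : ‖Y3‖ ≤ ‖Y0‖ + ‖Y1‖ + ‖Y2‖ := le_of_sum_eq_zero (by rw [← hsum]; abel)
  simp only [n0, n1, n2, n3, ← mul_add, mul_le_mul_iff_right₀ (Real.sqrt_pos.2 (zero_lt_two' ℝ))]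
    at i0 i1 i2 i3
  fin_cases i <;> simp <;> linarith

end FrobeniusNorm

lemma exists_complex_triangle {a b d : ℝ} (ha : 0 ≤ a) (hd : 0 ≤ d) (hab : |a - b| ≤ d)
    (hd' : d ≤ a + b) :
    ∃ z w : ℂ, Complex.normSq z = a ^ 2 ∧ Complex.normSq w = b ^ 2 ∧ z + w = d := by
  rw [abs_le] at hab
  rcases hd.eq_or_lt with rfl | hd
  · obtain rfl : a = b := by linarith
    exact ⟨a, -a, by simp [sq], by simp [sq], by simp⟩
  set s := (d ^ 2 + a ^ 2 - b ^ 2) / (2 * d) with hs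
  have hsd : 2 * d * s = d ^ 2 + a ^ 2 - b ^ 2 := by rw [hs]; field_simp
  have hsa : s ≤ a := by
    rw [hs, div_le_iff₀ (by positivity)]; nlinarith
  have has : -a ≤ s := by
    rw [hs, le_div_iff₀ (by positivity)]; nlinarith
  have hh := Real.mul_self_sqrt (show 0 ≤ a ^ 2 - s ^ 2 by nlinarith)
  refine ⟨⟨s, √(a ^ 2 - s ^ 2)⟩, ⟨d - s, -√(a ^ 2 - s ^ 2)⟩, ?_, ?_, ?_⟩
  · rw [Complex.normSq_mk]; linarith
  · rw [Complex.normSq_mk]; linarith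
  · apply Complex.ext <;> simp

/-- A closed planar quadrilateral with prescribed side lengths. -/
lemma exists_complex_quadrilateral {x : Fin 4 → ℝ} (hx : ∀ i, 0 ≤ x i)
    (h : ∀ i, 2 * x i ≤ ∑ j, x j) :
    ∃ z : Fin 4 → ℂ, (∀ i, Complex.normSq (z i) = x i ^ 2) ∧ ∑ i, z i = 0 := by
  simp only [Fin.forall_fin_succ, Fin.sum_univ_four, IsEmpty.forall_iff, and_true] at *
  simp at h hx
  obtain ⟨hx0, hx1, hx2, hx3⟩ := hx
  obtain ⟨h0, h1, h2, h3⟩ := h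
  have hd : 0 ≤ max |x 0 - x 1| |x 2 - x 3| := le_max_of_le_left (abs_nonneg _)
  obtain ⟨z, w, hz, hw, hzw⟩ := exists_complex_triangle hx0 hd (le_max_left _ _)
    (max_le (abs_le.2 ⟨by linarith, by linarith⟩) (abs_le.2 ⟨by linarith, by linarith⟩))
  obtain ⟨z', w', hz', hw', hzw'⟩ := exists_complex_triangle hx2 hd (le_max_right _ _)
    (max_le (abs_le.2 ⟨by linarith, by linarith⟩) (abs_le.2 ⟨by linarith, by linarith⟩))
  refine ⟨![z, w, -z', -w'], ?_, ?_⟩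
  · simp [hz, hw, hz', hw']
  · simp
    linear_combination hzw - hzw'

lemma isSymExt_of_sum_eq_zero {p : Fin 4 → ℝ} (hp : ∑ i, p i = 1) {z : Fin 4 → ℂ}
    (hz : ∀ i, Complex.normSq (z i) = p i) (hz0 : ∑ i, z i = 0) :
    IsSymExt (bellDiagonal p) ((1 / 4 : ℂ) •
      ((∑ i, z i • teleportMatrix i) * (∑ i, z i • teleportMatrix i)ᴴ)) := by
  have hz' (i) : z i * (starRingEnd ℂ) (z i) = p i := by rw [Complex.mul_conj, hz]
  have hp' : (p 0 + p 1 + p 2 + p 3 : ℂ) = 1 := by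
    rw [← Fin.sum_univ_four (fun i => (p i : ℂ)), ← Complex.ofReal_sum, hp, Complex.ofReal_one]
  have q0 := hz' 0
  have q1 := hz' 1
  have q2 := hz' 2
  have q3 := hz' 3
  set Y := ∑ i, z i • teleportMatrix i with hY
  have marginal (a a' b b') :
      ∑ c, ((1 / 4 : ℂ) • (Y * Yᴴ)) (a, b, c) (a', b', c) =
        bellDiagonal p (a, b) (a', b') := by
    fin_cases a <;> fin_cases a' <;> fin_cases b <;> fin_cases b' <;>
      simp [hY, bellDiagonal, ← hz', teleportMatrix, bellMatrix, Matrix.mul_apply,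
        Fin.sum_univ_four] <;> ring
  have swap_eq (a b c k) : Y (a, b, c) k = Y (a, c, b) k := by
    rw [Fin.sum_univ_four] at hz0
    fin_cases a <;> fin_cases b <;> fin_cases c <;> fin_cases k <;>
      simp [hY, teleportMatrix, bellMatrix, Matrix.mul_apply, Fin.sum_univ_four] <;>
      grind
  refine ⟨(Matrix.posSemidef_self_mul_conjTranspose Y).smul (by simp), ?_, marginal, ?_⟩
  · rw [Matrix.trace, Fintype.sum_prod_type]
    simp only [Fintype.sum_prod_type (α₁ := Fin 2) (α₂ := Fin 2), Matrix.diag_apply, marginal]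
    simp [bellDiagonal, bellMatrix, Fin.sum_univ_four]
    linear_combination hp'
  · intro a b c a' b' c'
    simp only [Matrix.smul_apply, Matrix.mul_apply, Matrix.conjTranspose_apply, swap_eq a b c,
      swap_eq a' b' c']

/-- Brahmagupta's product for the quadrilateral with sides `x i`. -/
lemma polygon_inequality_iff {x : Fin 4 → ℝ} (hx : ∀ i, 0 ≤ x i) :
    (∀ i, 2 * x i ≤ ∑ j, x j) ↔ 0 ≤ ∏ i, (∑ j, x j - 2 * x i) := by
  refine ⟨fun h => Finset.prod_nonneg fun i _ => sub_nonneg.2 (h i), fun h i => ?_⟩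
  by_contra! hi
  refine h.not_gt ?_
  rw [← Finset.mul_prod_erase _ _ (Finset.mem_univ i)]
  refine mul_neg_of_neg_of_pos (sub_neg.2 hi) (Finset.prod_pos fun j hj => ?_)
  have hij : x i + x j ≤ ∑ j, x j :=
    Finset.add_le_sum (fun k _ => hx k) (Finset.mem_univ i) (Finset.mem_univ j)
      (Finset.ne_of_mem_erase hj).symm
  linarith

lemma exists_isSymExt_bellDiagonal_iff {p : Fin 4 → ℝ} (hp : ∀ i, 0 ≤ p i) (hp1 : ∑ i, p i = 1) :
    (∃ σ, IsSymExt (bellDiagonal p) σ) ↔ ∀ i, 2 * √(p i) ≤ ∑ j, √(p j) := by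
  refine ⟨fun ⟨σ, h⟩ => h.sqrt_le_sum_sqrt, fun h => ?_⟩
  obtain ⟨z, hz, hz0⟩ := exists_complex_quadrilateral (fun i => Real.sqrt_nonneg (p i)) h
  exact ⟨_, isSymExt_of_sum_eq_zero hp1 (fun i => (hz i).trans (Real.sq_sqrt (hp i))) hz0⟩


/-- Symmetric extendibility of Bell-diagonal states. -/
theorem stmt_12 (pI pX pY pZ : ℝ)
    (hI : 0 ≤ pI) (hX : 0 ≤ pX) (hY : 0 ≤ pY) (hZ : 0 ≤ pZ)
    (hsum : pI + pX + pY + pZ = 1)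
    (PhiP PhiM PsiP PsiM : (Fin 2 × Fin 2) → ℂ)
    (hPhiP : PhiP = fun x => if x = (0, 0) ∨ x = (1, 1) then ((Real.sqrt 2)⁻¹ : ℂ) else 0)
    (hPhiM : PhiM = fun x => if x = (0, 0) then ((Real.sqrt 2)⁻¹ : ℂ)
      else if x = (1, 1) then -((Real.sqrt 2)⁻¹ : ℂ) else 0)
    (hPsiP : PsiP = fun x => if x = (0, 1) ∨ x = (1, 0) then ((Real.sqrt 2)⁻¹ : ℂ) else 0)
    (hPsiM : PsiM = fun x => if x = (0, 1) then ((Real.sqrt 2)⁻¹ : ℂ)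
      else if x = (1, 0) then -((Real.sqrt 2)⁻¹ : ℂ) else 0)
    (ρ : Matrix (Fin 2 × Fin 2) (Fin 2 × Fin 2) ℂ)
    (hρdef : ρ = (pI : ℂ) • vecMulVec PhiP (star PhiP) +
      (pZ : ℂ) • vecMulVec PhiM (star PhiM) +
      (pX : ℂ) • vecMulVec PsiP (star PsiP) +
      (pY : ℂ) • vecMulVec PsiM (star PsiM)) :
    (∃ σ, IsSymExt ρ σ) ↔
      4 * Real.sqrt (pI * pX * pY * pZ) ≥ (pI ^ 2 + pX ^ 2 + pY ^ 2 + pZ ^ 2) - 1 / 2 := by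
  have h2 : ((Real.sqrt 2 : ℂ))⁻¹ * (Real.sqrt 2 : ℂ)⁻¹ = 1 / 2 := by
    rw [← mul_inv, ← Complex.ofReal_mul, Real.mul_self_sqrt zero_le_two]
    norm_num
  have hρ : ρ = bellDiagonal ![pI, pZ, pX, pY] := by
    subst hPhiP hPhiM hPsiP hPsiM hρdef
    generalize (Real.sqrt 2) = r at *
    ext ⟨a, b⟩ ⟨a', b'⟩
    fin_cases a <;> fin_cases b <;> fin_cases a' <;> fin_cases b' <;>
      simp [vecMulVec_apply, bellDiagonal, bellMatrix, Fin.sum_univ_four, h2] <;> ring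
  rw [hρ, exists_isSymExt_bellDiagonal_iff (by simp [Fin.forall_fin_succ, *])
    (by rw [← hsum]; simp [Fin.sum_univ_four]; ring),
    polygon_inequality_iff (fun i => Real.sqrt_nonneg _)]
  simp only [Fin.prod_univ_four, Fin.sum_univ_four, Matrix.cons_val]
  rw [Real.sqrt_mul (by positivity), Real.sqrt_mul (by positivity), Real.sqrt_mul hI]
  have sI := Real.sq_sqrt hI
  have sX := Real.sq_sqrt hX
  have sY := Real.sq_sqrt hY
  have sZ := Real.sq_sqrt hZ
  generalize √pI = i, √pX = x, √pY = y, √pZ = z at *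
  subst sI sX sY sZ
  have key : (i + z + x + y - 2 * i) * (i + z + x + y - 2 * z) * (i + z + x + y - 2 * x) *
      (i + z + x + y - 2 * y) = 2 * (4 * (i * x * y * z) -
        ((i ^ 2) ^ 2 + (x ^ 2) ^ 2 + (y ^ 2) ^ 2 + (z ^ 2) ^ 2 - 1 / 2)) := by
    linear_combination (i ^ 2 + x ^ 2 + y ^ 2 + z ^ 2 + 1) * hsum
  rw [key]
  constructor <;> intro h <;> linarith
end
end

section
/- Let ρ be the two-qubit state which, in the product basis |00⟩,|01⟩,|10⟩,|11⟩, is the matrix with diagonal entries p₁, p₂, p₃, p₄ (nonnegative, summing to 1, with p₁ ≥ p₂, p₃, p₄), entries x ≥ 0 at positions (00,11) and (11,00), entries y ≥ 0 at positions (01,10) and (10,01), and zeros elsewhere, and assume ρ is positive semidefinite (i.e., x² ≤ p₁p₄ and y² ≤ p₂p₃). Then ρ admits a symmetric extension if and only if there exist s ∈ [0, min(p₃,p₄)] and t ∈ [0, p₂] such that x ≤ √s·√(p₁−t) + √t·√(p₄−s) and y ≤ √s·√(p₂−t) + √t·√(p₃−s). -/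
open Matrix Kronecker ComplexOrder

noncomputable section

/-- The entries of a positive semidefinite matrix satisfy the Cauchy-Schwarz inequality. -/
theorem norm_entry_le_of_posSemidef {n : Type*} [Finite n] {σ : Matrix n n ℂ}
    (hσ : σ.PosSemidef) (i j : n) :
    ‖σ i j‖ ≤ Real.sqrt (σ i i).re * Real.sqrt (σ j j).re := by
  have hdet := (hσ.submatrix ![i, j]).det_nonneg
  have hii := Complex.le_def.1 (hσ.diag_nonneg (i := i))
  have hji : σ j i = star (σ i j) := (hσ.isHermitian.apply j i).symm
  rw [Matrix.det_fin_two] at hdet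
  have hre := (Complex.le_def.1 hdet).1
  simp only [Matrix.submatrix_apply, Matrix.cons_val_zero, Matrix.cons_val_one, hji,
    Complex.sub_re, Complex.mul_re, Complex.star_def, Complex.conj_re, Complex.conj_im,
    Complex.zero_re] at hre
  have hi0 : (σ i i).im = 0 := by simpa using hii.2.symm
  rw [← Real.sqrt_mul (by simpa using hii.1)]
  apply Real.le_sqrt_of_sq_le
  rw [Complex.sq_norm, Complex.normSq_apply]
  rw [hi0] at hre
  linarith

/-- A sum of two real rank-one projectors and a nonnegative diagonal is positive semidefinite. -/
theorem posSemidef_rankOne_add_rankOne_add_diagonal {n : Type*} [Fintype n] [DecidableEq n]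
    (u v d : n → ℝ) (hd : ∀ i, 0 ≤ d i) :
    (Matrix.of fun i j =>
      ((u i * u j + v i * v j + if i = j then d i else 0 : ℝ) : ℂ)).PosSemidef := by
  have h := ((Matrix.posSemidef_vecMulVec_self_star fun i => (u i : ℂ)).add
    (Matrix.posSemidef_vecMulVec_self_star fun i => (v i : ℂ))).add
    (Matrix.PosSemidef.diagonal (d := fun i => (d i : ℂ))
      (fun i => by simpa using hd i))
  convert h using 1
  ext i j
  by_cases hij : i = j <;> simp [Matrix.vecMulVec_apply, hij]

/-- A nonnegative number below `X` is a multiple of `X` by a factor of modulus at most one. -/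
theorem exists_eq_mul_of_le {x X : ℝ} (hx : 0 ≤ x) (hX : x ≤ X) :
    ∃ c : ℝ, c ^ 2 ≤ 1 ∧ x = c * X := by
  rcases eq_or_lt_of_le (hx.trans hX) with h | h
  · exact ⟨0, by norm_num, by linarith⟩
  · refine ⟨x / X, ?_, by field_simp⟩
    exact pow_le_one₀ (by positivity) ((div_le_one h).2 hX)

/-- Necessary and sufficient conditions for symmetric extension of Z-correlated
two-qubit states. -/
theorem stmt_13 (p₁ p₂ p₃ p₄ x₀ y₀ : ℝ)
    (h1 : 0 ≤ p₁) (h2 : 0 ≤ p₂) (h3 : 0 ≤ p₃) (h4 : 0 ≤ p₄)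
    (hsum : p₁ + p₂ + p₃ + p₄ = 1)
    (h12 : p₂ ≤ p₁) (h13 : p₃ ≤ p₁) (h14 : p₄ ≤ p₁)
    (hx : 0 ≤ x₀) (hy : 0 ≤ y₀)
    (hxpsd : x₀ ^ 2 ≤ p₁ * p₄) (hypsd : y₀ ^ 2 ≤ p₂ * p₃)
    (ρ : Matrix (Fin 2 × Fin 2) (Fin 2 × Fin 2) ℂ)
    (hρdef : ρ = fun a b =>
      if a = (0, 0) ∧ b = (0, 0) then (p₁ : ℂ)
      else if a = (0, 1) ∧ b = (0, 1) then (p₂ : ℂ)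
      else if a = (1, 0) ∧ b = (1, 0) then (p₃ : ℂ)
      else if a = (1, 1) ∧ b = (1, 1) then (p₄ : ℂ)
      else if (a = (0, 0) ∧ b = (1, 1)) ∨ (a = (1, 1) ∧ b = (0, 0)) then (x₀ : ℂ)
      else if (a = (0, 1) ∧ b = (1, 0)) ∨ (a = (1, 0) ∧ b = (0, 1)) then (y₀ : ℂ)
      else 0) :
    (∃ σ, IsSymExt ρ σ) ↔
    ∃ s t : ℝ, 0 ≤ s ∧ s ≤ min p₃ p₄ ∧ 0 ≤ t ∧ t ≤ p₂ ∧
      x₀ ≤ Real.sqrt s * Real.sqrt (p₁ - t) + Real.sqrt t * Real.sqrt (p₄ - s) ∧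
      y₀ ≤ Real.sqrt s * Real.sqrt (p₂ - t) + Real.sqrt t * Real.sqrt (p₃ - s) := by
  subst hρdef
  constructor
  · rintro ⟨σ, hσ, -, hρ, hswap⟩
    have hdiag (i) : 0 ≤ (σ i i).re := (Complex.le_def.1 (hσ.diag_nonneg (i := i))).1
    have e1 := congrArg Complex.re (hρ 0 0 0 0)
    have e2 := congrArg Complex.re (hρ 0 0 1 1)
    have e3 := congrArg Complex.re (hρ 1 1 0 0)
    have e4 := congrArg Complex.re (hρ 1 1 1 1)
    have ex := congrArg Complex.re (hρ 0 1 0 1)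
    have ey := congrArg Complex.re (hρ 0 1 1 0)
    simp [Fin.sum_univ_two] at e1 e2 e3 e4 ex ey
    have hs := congrArg Complex.re (hswap 1 1 0 1 1 0)
    have ht := congrArg Complex.re (hswap 0 1 0 0 1 0)
    have cauchy (i j) := (Complex.re_le_norm (σ i j)).trans (norm_entry_le_of_posSemidef hσ i j)
    have c1 := cauchy (0, 0, 0) (1, 1, 0)
    have c2 := cauchy (0, 0, 1) (1, 1, 1)
    have c3 := cauchy (0, 1, 0) (1, 0, 0)
    have c4 := cauchy (0, 1, 1) (1, 0, 1)
    have d1 := hdiag (1, 0, 0)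
    have d2 := hdiag (1, 1, 1)
    have d3 := hdiag (0, 1, 1)
    refine ⟨(σ (1, 1, 0) (1, 1, 0)).re, (σ (0, 0, 1) (0, 0, 1)).re, hdiag _,
      le_min (by linarith) (by linarith), hdiag _, by linarith, ?_, ?_⟩
    · rw [← e1, ← e4, ← ex, add_sub_cancel_right, add_sub_cancel_left]
      linarith
    · rw [← e2, ← e3, ← ey, hs, ← ht, add_sub_cancel_right, add_sub_cancel_left]
      linarith
  · rintro ⟨s, t, hs, hs', ht, ht', hX, hY⟩
    obtain ⟨l, hl, hxl⟩ := exists_eq_mul_of_le hx hX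
    obtain ⟨m, hm, hym⟩ := exists_eq_mul_of_le hy hY
    have hs3 : 0 ≤ p₃ - s := sub_nonneg.2 (hs'.trans (min_le_left _ _))
    have hs4 : 0 ≤ p₄ - s := sub_nonneg.2 (hs'.trans (min_le_right _ _))
    have ht1 : 0 ≤ p₁ - t := by linarith
    have ht2 : 0 ≤ p₂ - t := by linarith
    have qs := Real.mul_self_sqrt hs
    have qt := Real.mul_self_sqrt ht
    have q1 := Real.mul_self_sqrt ht1
    have q2 := Real.mul_self_sqrt ht2
    have q3 := Real.mul_self_sqrt hs3
    have q4 := Real.mul_self_sqrt hs4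
    set rs := Real.sqrt s
    set rt := Real.sqrt t
    set r1 := Real.sqrt (p₁ - t)
    set r2 := Real.sqrt (p₂ - t)
    set r3 := Real.sqrt (p₃ - s)
    set r4 := Real.sqrt (p₄ - s)
    let u : Fin 2 × Fin 2 × Fin 2 → ℝ := fun i =>
      ![![![l * r1, 0], ![0, m * r2]], ![![0, rs], ![rs, 0]]] i.1 i.2.1 i.2.2
    let v : Fin 2 × Fin 2 × Fin 2 → ℝ := fun i =>
      ![![![0, rt], ![rt, 0]], ![![m * r3, 0], ![0, l * r4]]] i.1 i.2.1 i.2.2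
    let d : Fin 2 × Fin 2 × Fin 2 → ℝ := fun i =>
      ![![![(1 - l ^ 2) * (p₁ - t), 0], ![0, (1 - m ^ 2) * (p₂ - t)]],
        ![![(1 - m ^ 2) * (p₃ - s), 0], ![0, (1 - l ^ 2) * (p₄ - s)]]] i.1 i.2.1 i.2.2
    have hd : ∀ i, 0 ≤ d i := by
      rintro ⟨a, b, c⟩
      have hl' := sub_nonneg.2 hl
      have hm' := sub_nonneg.2 hm
      fin_cases a <;> fin_cases b <;> fin_cases c <;> simp [d] <;> positivity
    refine ⟨_, posSemidef_rankOne_add_rankOne_add_diagonal u v d hd, ?_, ?_, ?_⟩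
    · simp only [Matrix.trace, Matrix.diag, Matrix.of_apply, ← Complex.ofReal_sum]
      norm_cast
      simp [Fintype.sum_prod_type, Fin.sum_univ_two, u, v, d]
      linear_combination hsum + 2 * qs + 2 * qt + l ^ 2 * q1 + m ^ 2 * q2 + m ^ 2 * q3 + l ^ 2 * q4
    · intro a a' b b'
      simp only [Fin.sum_univ_two, Matrix.of_apply, ← Complex.ofReal_add]
      fin_cases a <;> fin_cases a' <;> fin_cases b <;> fin_cases b' <;>
        simp [u, v, d] <;> norm_cast
      · linear_combination l ^ 2 * q1 + qt
      · linear_combination m ^ 2 * q2 + qt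
      · linear_combination -hxl
      · linear_combination -hym
      · linear_combination -hym
      · linear_combination -hxl
      · linear_combination m ^ 2 * q3 + qs
      · linear_combination l ^ 2 * q4 + qs
    · intro a b₁ b₂ a' b₁' b₂'
      fin_cases a <;> fin_cases a' <;> fin_cases b₁ <;> fin_cases b₁' <;> fin_cases b₂ <;>
        fin_cases b₂' <;> simp [u, v, d]
end
end

section
/- Let ρ be the two-qubit state which, in the product basis |00⟩,|01⟩,|10⟩,|11⟩, is the matrix with diagonal entries p₁, p₂, p₃, p₄ (nonnegative, summing to 1, with p₁ ≥ p₂, p₃, p₄), entries x ≥ 0 at positions (00,11) and (11,00), and zeros elsewhere, with x² ≤ p₁p₄ (so ρ is positive semidefinite). Then ρ admits a symmetric extension if and only if either p₁p₃ + p₂p₄ ≥ p₁p₄, or x ≤ √p₃·√(p₁−p₂) + √p₂·√(p₄−p₃). -/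
open Matrix Kronecker ComplexOrder

noncomputable section

/-- Each off-diagonal entry of a positive semidefinite matrix is bounded by the geometric mean of
the corresponding diagonal entries. -/
theorem Matrix.PosSemidef.re_apply_le_sqrt_mul_sqrt {n : Type*} {M : Matrix n n ℂ}
    (hM : M.PosSemidef) (i j : n) :
    (M i j).re ≤ √(M i i).re * √(M j j).re := by
  have hi : 0 ≤ M i i := hM.diag_nonneg
  have hj : 0 ≤ M j j := hM.diag_nonneg
  have hdet := (hM.submatrix ![i, j]).det_nonneg
  rw [Matrix.det_fin_two] at hdet
  have hji : M j i = star (M i j) := (hM.isHermitian.apply j i).symm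
  simp only [submatrix_apply, cons_val_zero, cons_val_one, hji] at hdet
  rw [Complex.le_def] at hi hj hdet
  simp only [Complex.zero_re, Complex.zero_im, Complex.sub_re, Complex.mul_re, Complex.star_def,
    Complex.conj_re, Complex.conj_im] at hi hj hdet
  rw [← Real.sqrt_mul hi.1]
  apply Real.le_sqrt_of_sq_le
  rw [← hi.2, ← hj.2] at hdet
  nlinarith [sq_nonneg (M i j).im, hdet.1]

/-- On the circle of squared radius `A`, the linear functional with coefficients `a, b` increases
along the arc up to the direction `(a, b)`. -/
theorem sqrt_sub_mul_add_sqrt_mul_le {A t t' a b : ℝ} (ht : t ≤ t') (hA : t' ≤ A)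
    (ht₀ : 0 ≤ t) (ha : 0 ≤ a) (hb : 0 ≤ b) (h : √t' * a ≤ √(A - t') * b) :
    √(A - t) * a + √t * b ≤ √(A - t') * a + √t' * b := by
  have hd : √t ≤ √t' := Real.sqrt_le_sqrt ht
  have hc : √(A - t') ≤ √(A - t) := Real.sqrt_le_sqrt (by linarith)
  have hd2 := Real.sq_sqrt ht₀
  have hd2' := Real.sq_sqrt (ht₀.trans ht)
  have hc2 : √(A - t) ^ 2 = A - t := Real.sq_sqrt (by linarith)
  have hc2' : √(A - t') ^ 2 = A - t' := Real.sq_sqrt (by linarith)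
  have hc0' := Real.sqrt_nonneg (A - t')
  generalize √t = d at *
  generalize √t' = d' at *
  generalize √(A - t) = c at *
  generalize √(A - t') = c' at *
  rcases (add_nonneg (hc0'.trans hc) hc0').eq_or_lt with h0 | h0
  · obtain rfl : c = c' := by linarith
    nlinarith
  · have key : (d' + d) * a ≤ (c + c') * b := by nlinarith
    have hcirc : (c - c') * (c + c') = (d' - d) * (d' + d) := by
      linear_combination hc2 - hc2' + hd2 - hd2'
    have : (c - c') * a * (c + c') ≤ (d' - d) * b * (c + c') := by
      calc (c - c') * a * (c + c') = (d' - d) * ((d' + d) * a) := by linear_combination a * hcirc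
        _ ≤ (d' - d) * ((c + c') * b) := mul_le_mul_of_nonneg_left key (by linarith)
        _ = _ := by ring
    linarith [le_of_mul_le_mul_right this h0]

/-- Below the line `p₁ s + p₄ t = p₁ p₄`, the overlap `√((p₁ - t) s) + √(t (p₄ - s))` is monotone
in `s` and `t`. -/
theorem sqrt_overlap_le {p₁ p₂ p₃ p₄ s t : ℝ} (h1 : 0 ≤ p₁) (h12 : p₂ ≤ p₁)
    (h34 : p₃ ≤ p₄) (ht : 0 ≤ t) (ht2 : t ≤ p₂) (hs : 0 ≤ s) (hs3 : s ≤ p₃)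
    (h : p₁ * p₃ + p₂ * p₄ ≤ p₁ * p₄) :
    √(p₁ - t) * √s + √t * √(p₄ - s) ≤ √p₃ * √(p₁ - p₂) + √p₂ * √(p₄ - p₃) := by
  have h₁ : √(p₁ - t) * √s + √t * √(p₄ - s) ≤ √(p₁ - p₂) * √s + √p₂ * √(p₄ - s) := by
    refine sqrt_sub_mul_add_sqrt_mul_le ht2 h12 ht (Real.sqrt_nonneg _) (Real.sqrt_nonneg _) ?_
    rw [← Real.sqrt_mul (ht.trans ht2), ← Real.sqrt_mul (by linarith)]
    exact Real.sqrt_le_sqrt (by nlinarith)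
  have h₂ : √(p₄ - s) * √p₂ + √s * √(p₁ - p₂) ≤ √(p₄ - p₃) * √p₂ + √p₃ * √(p₁ - p₂) := by
    refine sqrt_sub_mul_add_sqrt_mul_le hs3 h34 hs (Real.sqrt_nonneg _) (Real.sqrt_nonneg _) ?_
    rw [← Real.sqrt_mul (hs.trans hs3), ← Real.sqrt_mul (by linarith)]
    exact Real.sqrt_le_sqrt (by nlinarith)
  linarith

/-- A splitting of the weights and of the coherence of a Z-correlated two-qubit state which
yields a symmetric extension. -/
theorem exists_weights {p₁ p₂ p₃ p₄ x : ℝ} (h1 : 0 < p₁) (h2 : 0 ≤ p₂) (h3 : 0 ≤ p₃) (h4 : 0 ≤ p₄)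
    (h12 : p₂ ≤ p₁) (hx : 0 ≤ x) (hxpsd : x ^ 2 ≤ p₁ * p₄)
    (h : p₁ * p₄ ≤ p₁ * p₃ + p₂ * p₄ ∨ x ≤ √p₃ * √(p₁ - p₂) + √p₂ * √(p₄ - p₃)) :
    ∃ s t u v : ℝ, 0 ≤ s ∧ s ≤ p₃ ∧ s ≤ p₄ ∧ 0 ≤ t ∧ t ≤ p₂ ∧
      u ^ 2 ≤ (p₁ - t) * s ∧ v ^ 2 ≤ (p₄ - s) * t ∧ u + v = x := by
  rcases le_or_gt p₄ p₃ with h43 | h34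
  · exact ⟨p₄, 0, x, 0, h4, h43, le_rfl, le_rfl, h2, by simpa using hxpsd, by simp, by simp⟩
  have h4' : 0 < p₄ := h3.trans_lt h34
  rcases h with h | h
  · have hx2 : x ^ 2 / p₄ ≤ p₁ := (div_le_iff₀ h4').2 hxpsd
    refine ⟨p₃, p₁ * (p₄ - p₃) / p₄, x * p₃ / p₄, x * (p₄ - p₃) / p₄, h3, le_rfl, h34.le,
      div_nonneg (mul_nonneg h1.le (by linarith)) h4, (div_le_iff₀ h4').2 (by linarith),
      ?_, ?_, by field_simp; ring⟩
    · calc (x * p₃ / p₄) ^ 2 = x ^ 2 / p₄ * (p₃ ^ 2 / p₄) := by field_simp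
        _ ≤ p₁ * (p₃ ^ 2 / p₄) := mul_le_mul_of_nonneg_right hx2 (by positivity)
        _ = _ := by field_simp; ring
    · calc (x * (p₄ - p₃) / p₄) ^ 2 = x ^ 2 / p₄ * ((p₄ - p₃) ^ 2 / p₄) := by field_simp
        _ ≤ p₁ * ((p₄ - p₃) ^ 2 / p₄) := mul_le_mul_of_nonneg_right hx2 (by positivity)
        _ = _ := by field_simp
  · have hu0 : 0 ≤ √p₃ * √(p₁ - p₂) := by positivity
    have hv0 : 0 ≤ √p₂ * √(p₄ - p₃) := by positivity
    have hu2 : (√p₃ * √(p₁ - p₂)) ^ 2 = (p₁ - p₂) * p₃ := by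
      rw [mul_pow, Real.sq_sqrt h3, Real.sq_sqrt (by linarith), mul_comm]
    have hv2 : (√p₂ * √(p₄ - p₃)) ^ 2 = (p₄ - p₃) * p₂ := by
      rw [mul_pow, Real.sq_sqrt h2, Real.sq_sqrt (by linarith), mul_comm]
    refine ⟨p₃, p₂, min x (√p₃ * √(p₁ - p₂)), x - min x (√p₃ * √(p₁ - p₂)), h3, le_rfl, h34.le, h2,
      le_rfl, ?_, ?_, by ring⟩
    · rw [← hu2]
      exact pow_le_pow_left₀ (le_min hx hu0) (min_le_right _ _) 2
    · rw [← hv2]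
      refine pow_le_pow_left₀ (sub_nonneg.2 (min_le_left _ _)) ?_ 2
      rcases min_cases x (√p₃ * √(p₁ - p₂)) with ⟨e, -⟩ | ⟨e, -⟩ <;> rw [e] <;> linarith

/-- The extension with weight `s` on `|110⟩, |101⟩`, weight `t` on `|001⟩, |010⟩`, and coherences
`u, v` between these pairs and `|000⟩`, `|111⟩` respectively. -/
def zExt (p₁ p₂ p₃ p₄ s t u v : ℝ) : Matrix (Fin 2 × Fin 2 × Fin 2) (Fin 2 × Fin 2 × Fin 2) ℂ :=
  let w (a : Fin 2) (r : ℝ) : Fin 2 × Fin 2 × Fin 2 → ℂ := fun i =>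
    if i = (a, a, a) then (r : ℂ) else if i = (1 - a, 0, 1) ∨ i = (1 - a, 1, 0) then 1 else 0
  let d : Fin 2 × Fin 2 × Fin 2 → ℝ := fun i =>
    if i = (0, 0, 0) then p₁ - t - u ^ 2 / s
    else if i = (1, 1, 1) then p₄ - s - v ^ 2 / t
    else if i = (0, 1, 1) then p₂ - t
    else if i = (1, 0, 0) then p₃ - s
    else 0
  diagonal (fun i => (d i : ℂ)) + s • vecMulVec (w 0 (u / s)) (star (w 0 (u / s)))
    + t • vecMulVec (w 1 (v / t)) (star (w 1 (v / t)))

theorem zExt_posSemidef {p₁ p₂ p₃ p₄ s t u v : ℝ} (hs : 0 ≤ s) (hs3 : s ≤ p₃) (hs4 : s ≤ p₄)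
    (ht : 0 ≤ t) (ht1 : t ≤ p₁) (ht2 : t ≤ p₂) (hu : u ^ 2 ≤ (p₁ - t) * s)
    (hv : v ^ 2 ≤ (p₄ - s) * t) : (zExt p₁ p₂ p₃ p₄ s t u v).PosSemidef := by
  refine ((PosSemidef.diagonal fun i => ?_).add
    ((posSemidef_vecMulVec_self_star _).smul hs)).add ((posSemidef_vecMulVec_self_star _).smul ht)
  have hu' := div_le_of_le_mul₀ hs (sub_nonneg.2 ht1) hu
  have hv' := div_le_of_le_mul₀ ht (sub_nonneg.2 hs4) hv
  simp only [Pi.zero_apply, Complex.zero_le_real]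
  split_ifs <;> linarith

/-- Symmetric extendibility for Z-correlated two-qubit states with `y = 0`. -/
theorem stmt_14 (p₁ p₂ p₃ p₄ x₀ : ℝ)
    (h1 : 0 ≤ p₁) (h2 : 0 ≤ p₂) (h3 : 0 ≤ p₃) (h4 : 0 ≤ p₄)
    (hsum : p₁ + p₂ + p₃ + p₄ = 1)
    (h12 : p₂ ≤ p₁) (h13 : p₃ ≤ p₁) (h14 : p₄ ≤ p₁)
    (hx : 0 ≤ x₀) (hxpsd : x₀ ^ 2 ≤ p₁ * p₄)
    (ρ : Matrix (Fin 2 × Fin 2) (Fin 2 × Fin 2) ℂ)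
    (hρdef : ρ = fun a b =>
      if a = (0, 0) ∧ b = (0, 0) then (p₁ : ℂ)
      else if a = (0, 1) ∧ b = (0, 1) then (p₂ : ℂ)
      else if a = (1, 0) ∧ b = (1, 0) then (p₃ : ℂ)
      else if a = (1, 1) ∧ b = (1, 1) then (p₄ : ℂ)
      else if (a = (0, 0) ∧ b = (1, 1)) ∨ (a = (1, 1) ∧ b = (0, 0)) then (x₀ : ℂ)
      else 0) :
    (∃ σ, IsSymExt ρ σ) ↔
    (p₁ * p₄ ≤ p₁ * p₃ + p₂ * p₄ ∨
      x₀ ≤ Real.sqrt p₃ * Real.sqrt (p₁ - p₂) + Real.sqrt p₂ * Real.sqrt (p₄ - p₃)) := by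
  have hp1 : 0 < p₁ := by linarith
  constructor
  · rintro ⟨σ, hσ, -, hpt, hsw⟩
    rw [or_iff_not_imp_left, not_le]
    intro hlt
    have h34 : p₃ ≤ p₄ := by nlinarith [mul_nonneg h2 h4]
    have hnn (i) : 0 ≤ (σ i i).re := (Complex.le_def.1 hσ.diag_nonneg).1
    have e1 := congrArg Complex.re (hpt 0 0 0 0)
    have e2 := congrArg Complex.re (hpt 0 0 1 1)
    have e3 := congrArg Complex.re (hpt 1 1 0 0)
    have e4 := congrArg Complex.re (hpt 1 1 1 1)
    have ex := congrArg Complex.re (hpt 0 1 0 1)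
    simp [hρdef, Fin.sum_univ_two] at e1 e2 e3 e4 ex
    rw [hsw 0 1 0 0 1 0] at e2
    rw [hsw 1 0 1 1 0 1] at e3
    have hu := hσ.re_apply_le_sqrt_mul_sqrt (0, 0, 0) (1, 1, 0)
    have hv := hσ.re_apply_le_sqrt_mul_sqrt (0, 0, 1) (1, 1, 1)
    have hmax := sqrt_overlap_le (s := (σ (1, 1, 0) (1, 1, 0)).re)
      (t := (σ (0, 0, 1) (0, 0, 1)).re) h1 h12 h34 (hnn _) (by linarith [hnn (0, 1, 1)])
      (hnn _) (by linarith [hnn (1, 0, 0)]) hlt.le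
    rw [← e1, ← e4, add_sub_cancel_right, add_sub_cancel_left, e1, e4] at hmax
    linarith
  · intro h
    obtain ⟨s, t, u, v, hs, hs3, hs4, ht, ht2, hu, hv, rfl⟩ :=
      exists_weights hp1 h2 h3 h4 h12 hx hxpsd h
    have hus : s = 0 → u = 0 := by rintro rfl; nlinarith
    have hvt : t = 0 → v = 0 := by rintro rfl; nlinarith
    have hpt : ∀ a a' b b', ∑ c, zExt p₁ p₂ p₃ p₄ s t u v (a, b, c) (a', b', c) =
        ρ (a, b) (a', b') := by
      have hsu : (s : ℂ) * (u / s) = u := mul_div_cancel_of_imp' (by exact_mod_cast hus)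
      have htv : (t : ℂ) * (v / t) = v := mul_div_cancel_of_imp' (by exact_mod_cast hvt)
      have hsu2 : (s : ℂ) * (u / s * (u / s)) = u ^ 2 / s := by rw [← mul_assoc, hsu]; ring
      have htv2 : (t : ℂ) * (v / t * (v / t)) = v ^ 2 / t := by rw [← mul_assoc, htv]; ring
      subst hρdef
      intro a a' b b'
      fin_cases a <;> fin_cases a' <;> fin_cases b <;> fin_cases b' <;>
        simp [zExt, Fin.sum_univ_two, vecMulVec_apply, hsu, htv, hsu2, htv2]
    refine ⟨zExt p₁ p₂ p₃ p₄ s t u v,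
      zExt_posSemidef hs hs3 hs4 ht (ht2.trans h12) ht2 hu hv, ?_, hpt, ?_⟩
    · have htr : (zExt p₁ p₂ p₃ p₄ s t u v).trace = ∑ a, ∑ b, ρ (a, b) (a, b) := by
        simp only [trace, diag_apply, Fintype.sum_prod_type, hpt]
      rw [htr, hρdef]
      simp [Fin.sum_univ_two]
      exact_mod_cast (by linarith : p₁ + p₂ + (p₃ + p₄) = 1)
    · intro a b₁ b₂ a' b₁' b₂'
      fin_cases a <;> fin_cases b₁ <;> fin_cases b₂ <;> fin_cases a' <;> fin_cases b₁' <;>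
        fin_cases b₂' <;> simp [zExt, vecMulVec_apply]
end
end

section
/- Let ρ be a bipartite state on A⊗B (arbitrary finite dimensions dA, dB) of rank 2 that admits a symmetric extension. Then its reduced state ρ_B has rank at most 2. -/
open Matrix Kronecker ComplexOrder

noncomputable section

/-- The span of all rows `b ↦ v (a, b)` of the elements `v` of a subspace of `A ⊗ B`. -/
def rowSpan {A B : Type*} (U : Submodule ℂ (A × B → ℂ)) : Submodule ℂ (B → ℂ) :=
  ⨆ a : A, U.map (LinearMap.funLeft ℂ ℂ (Prod.mk a))

/-- A tensor on `A ⊗ B ⊗ B` viewed as a linear map from the third factor to `A ⊗ B`. -/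
def thirdSlice {A B : Type*} (T : A × B × B → ℂ) : Matrix (A × B) B ℂ :=
  fun p c => T (p.1, p.2, c)

/-- A tensor on `A ⊗ B ⊗ B` viewed as a linear map from the second factor to `A ⊗ B`. -/
def secondSlice {A B : Type*} (T : A × B × B → ℂ) : Matrix (A × B) B ℂ :=
  fun p c => T (p.1, c, p.2)

lemma rowSpan_mono {A B : Type*} {U V : Submodule ℂ (A × B → ℂ)} (h : U ≤ V) :
    rowSpan U ≤ rowSpan V :=
  iSup_mono fun _ => Submodule.map_mono h

lemma rowSpan_sup {A B : Type*} (U V : Submodule ℂ (A × B → ℂ)) :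
    rowSpan (U ⊔ V) = rowSpan U ⊔ rowSpan V := by
  simp only [rowSpan, Submodule.map_sup, iSup_sup_eq]

section

variable {A B N : Type*} [Fintype A] [Fintype B] [Fintype N]

lemma finrank_rowSpan_thirdSlice_le (T : A × B × B → ℂ) :
    Module.finrank ℂ (rowSpan (LinearMap.range (thirdSlice T).mulVecLin)) ≤
      Module.finrank ℂ (LinearMap.range (secondSlice T).mulVecLin) := by
  classical
  change _ ≤ (secondSlice T).rank
  rw [← Matrix.rank_transpose]
  refine Submodule.finrank_mono (iSup_le fun a => ?_)
  rintro _ ⟨_, ⟨x, rfl⟩, rfl⟩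
  refine ⟨fun p => if p.1 = a then x p.2 else 0, ?_⟩
  ext b
  simp [Matrix.mulVec, Matrix.vecMul, dotProduct, LinearMap.funLeft, secondSlice, thirdSlice,
    Fintype.sum_prod_type, mul_comm]

lemma finrank_rowSpan_secondSlice_le (T : A × B × B → ℂ) :
    Module.finrank ℂ (rowSpan (LinearMap.range (secondSlice T).mulVecLin)) ≤
      Module.finrank ℂ (LinearMap.range (thirdSlice T).mulVecLin) :=
  finrank_rowSpan_thirdSlice_le fun p => T (p.1, p.2.2, p.2.1)

lemma finrank_rowSpan_le_two {ι : Type*} {S : Submodule ℂ (A × B → ℂ)}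
    (hS : Module.finrank ℂ S = 2) (U V : ι → Submodule ℂ (A × B → ℂ))
    (hU : ⨆ n, U n = S) (hV : ∀ n, V n ≤ S)
    (hUV : ∀ n, Module.finrank ℂ (rowSpan (U n)) ≤ Module.finrank ℂ (V n))
    (hVU : ∀ n, Module.finrank ℂ (rowSpan (V n)) ≤ Module.finrank ℂ (U n)) :
    Module.finrank ℂ (rowSpan S) ≤ 2 := by
  have hUS : ∀ n, U n ≤ S := fun n => hU ▸ le_iSup U n
  have hU2 : ∀ n, Module.finrank ℂ (U n) ≤ 2 := fun n => hS ▸ Submodule.finrank_mono (hUS n)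
  have hV2 : ∀ n, Module.finrank ℂ (V n) ≤ 2 := fun n => hS ▸ Submodule.finrank_mono (hV n)
  by_cases h₁ : ∃ n, Module.finrank ℂ (U n) = 2
  · obtain ⟨n, hn⟩ := h₁
    rw [← Submodule.eq_of_le_of_finrank_eq (hUS n) (hn.trans hS.symm)]
    exact (hUV n).trans (hV2 n)
  by_cases h₂ : ∃ n, Module.finrank ℂ (V n) = 2
  · obtain ⟨n, hn⟩ := h₂
    rw [← Submodule.eq_of_le_of_finrank_eq (hV n) (hn.trans hS.symm)]
    exact (hVU n).trans (hU2 n)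
  push Not at h₁ h₂
  obtain ⟨n, hn⟩ : ∃ n, U n ≠ ⊥ := by
    by_contra! h
    have hbot : S = ⊥ := by rw [← hU, iSup_eq_bot]; exact h
    rw [hbot, finrank_bot] at hS
    omega
  obtain ⟨m, hm⟩ : ∃ m, ¬ U m ≤ U n := by
    by_contra! h
    have hSn : S = U n := le_antisymm (hU ▸ iSup_le h) (hUS n)
    exact h₁ n (hSn ▸ hS)
  have hn0 : 0 < Module.finrank ℂ (U n) :=
    Nat.pos_of_ne_zero fun h => hn (Submodule.finrank_eq_zero.mp h)
  have hlt : Module.finrank ℂ (U n) < Module.finrank ℂ (U n ⊔ U m : Submodule ℂ (A × B → ℂ)) :=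
    Submodule.finrank_lt_finrank_of_lt (left_lt_sup.mpr hm)
  have hsup : U n ⊔ U m = S :=
    Submodule.eq_of_le_of_finrank_le (sup_le (hUS n) (hUS m)) (by omega)
  rw [← hsup, rowSpan_sup]
  have hadd := Submodule.finrank_add_le_finrank_add_finrank (rowSpan (U n)) (rowSpan (U m))
  have := hUV n
  have := hUV m
  have := hV2 n
  have := hV2 m
  have := h₂ n
  have := h₂ m
  omega

lemma range_reduceB_le (ρ : Matrix (A × B) (A × B) ℂ) :
    LinearMap.range (reduceB ρ).mulVecLin ≤ rowSpan (LinearMap.range ρ.mulVecLin) := by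
  classical
  rintro _ ⟨w, rfl⟩
  have h : (reduceB ρ).mulVecLin w = ∑ a : A, LinearMap.funLeft ℂ ℂ (Prod.mk a)
      (ρ.mulVecLin fun p => if p.1 = a then w p.2 else 0) := by
    ext b
    simp only [Matrix.mulVecLin_apply, Matrix.mulVec, dotProduct, reduceB, LinearMap.funLeft,
      Finset.sum_apply, Fintype.sum_prod_type, Finset.sum_mul, LinearMap.coe_mk, AddHom.coe_mk,
      Function.comp_apply]
    rw [Finset.sum_comm]
    simp
  rw [h]
  exact Submodule.sum_mem _ fun a _ =>
    Submodule.mem_iSup_of_mem a (Submodule.mem_map_of_mem (LinearMap.mem_range_self _ _))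

lemma range_mul_conjTranspose_self (G : Matrix A N ℂ) :
    LinearMap.range (G * Gᴴ).mulVecLin = LinearMap.range G.mulVecLin := by
  classical
  refine Submodule.eq_of_le_of_finrank_eq ?_ (Matrix.rank_self_mul_conjTranspose G)
  rw [Matrix.mulVecLin_mul]
  exact LinearMap.range_comp_le_range _ _

lemma range_mulVecLin_eq_iSup {A M N : Type*} [Fintype M] [Fintype N] (G : Matrix A (M × N) ℂ) :
    LinearMap.range G.mulVecLin =
      ⨆ m, LinearMap.range (Matrix.of fun i n => G i (m, n)).mulVecLin := by
  simp only [Matrix.range_mulVecLin]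
  rw [← Submodule.span_iUnion]
  congr 1
  ext v
  simp only [Set.mem_range, Set.mem_iUnion, Prod.exists]
  rfl

end

open scoped MatrixOrder Matrix.Norms.L2Operator in
lemma exists_eq_mul_conjTranspose_self {n : Type*} [Fintype n] [DecidableEq n]
    {σ : Matrix n n ℂ} (hσ : σ.PosSemidef) : ∃ F : Matrix n n ℂ, σ = F * Fᴴ :=
  CStarAlgebra.nonneg_iff_eq_mul_star_self.mp hσ.nonneg

/-- A rank-2 symmetric-extendible state has reduced state of rank at most 2. -/
theorem stmt_15 (dA dB : ℕ)
    (ρ : Matrix (Fin dA × Fin dB) (Fin dA × Fin dB) ℂ)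
    (hρ : ρ.PosSemidef) (hρtr : ρ.trace = 1) (hrank : ρ.rank = 2)
    (hext : ∃ σ, IsSymExt ρ σ) :
    (reduceB ρ).rank ≤ 2 := by
  obtain ⟨σ, hσ, -, hmarg, hswap⟩ := hext
  obtain ⟨F, hF⟩ := exists_eq_mul_conjTranspose_self hσ
  let G : Matrix (Fin dA × Fin dB) ((Fin dA × Fin dB × Fin dB) × Fin dB) ℂ :=
    fun p q => thirdSlice (fun t => F t q.1) p q.2
  let H : Matrix (Fin dA × Fin dB) ((Fin dA × Fin dB × Fin dB) × Fin dB) ℂ :=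
    fun p q => secondSlice (fun t => F t q.1) p q.2
  have hG : ρ = G * Gᴴ := by
    ext ⟨a, b⟩ ⟨a', b'⟩
    rw [← hmarg, hF, Matrix.mul_apply, Fintype.sum_prod_type_right]
    rfl
  have hH : ρ = H * Hᴴ := by
    ext ⟨a, b⟩ ⟨a', b'⟩
    rw [← hmarg]
    simp only [hswap a b]
    rw [hF, Matrix.mul_apply, Fintype.sum_prod_type_right]
    rfl
  have hGr : LinearMap.range ρ.mulVecLin = LinearMap.range G.mulVecLin := by
    rw [hG, range_mul_conjTranspose_self]
  have hHr : LinearMap.range ρ.mulVecLin = LinearMap.range H.mulVecLin := by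
    rw [hH, range_mul_conjTranspose_self]
  rw [range_mulVecLin_eq_iSup G] at hGr
  rw [range_mulVecLin_eq_iSup H] at hHr
  refine (Submodule.finrank_mono (range_reduceB_le ρ)).trans ?_
  exact finrank_rowSpan_le_two hrank
    (fun n => LinearMap.range (thirdSlice fun t => F t n).mulVecLin)
    (fun n => LinearMap.range (secondSlice fun t => F t n).mulVecLin)
    hGr.symm (fun n => (le_iSup (fun n =>
      LinearMap.range (secondSlice fun t => F t n).mulVecLin) n).trans hHr.ge)
    (fun n => finrank_rowSpan_thirdSlice_le _) (fun n => finrank_rowSpan_secondSlice_le _)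
end
end

section
/- Let ρ be a bipartite state on A⊗B where A is a qubit (dA = 2) and B has arbitrary finite dimension dB, and suppose ρ has rank 2. Then ρ admits a symmetric extension if and only if λ_max(ρ) ≤ λ_max(ρ_B) and the reduced state ρ_B has rank at most 2, where λ_max denotes the largest eigenvalue. -/
open Matrix Kronecker ComplexOrder

noncomputable section

open scoped MatrixOrder in
lemma Matrix.PosSemidef.exists_eq_mul_conjTranspose {n : Type*} [Fintype n] {A : Matrix n n ℂ}
    (hA : A.PosSemidef) : ∃ B : Matrix n n ℂ, A = B * Bᴴ := by
  classical
  obtain ⟨B, hB⟩ := CStarAlgebra.nonneg_iff_eq_star_mul_self.mp hA.nonneg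
  exact ⟨Bᴴ, by rw [conjTranspose_conjTranspose]; exact hB⟩

section Spectral

variable {n : Type*} [Fintype n] [DecidableEq n] {H : Matrix n n ℂ}

lemma Matrix.IsHermitian.exists_pair_eigenvalues (hH : H.IsHermitian) (hr : H.rank ≤ 2)
    (hn : 2 ≤ Fintype.card n) :
    ∃ i j, i ≠ j ∧ ∀ k, k ≠ i → k ≠ j → hH.eigenvalues k = 0 := by
  have hc : (Finset.univ.filter fun i => hH.eigenvalues i ≠ 0).card ≤ 2 := by
    rwa [← Fintype.card_subtype, ← hH.rank_eq_card_non_zero_eigs]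
  obtain ⟨t, ht, -, ht2⟩ := Finset.exists_subsuperset_card_eq
    (Finset.subset_univ (Finset.univ.filter fun i => hH.eigenvalues i ≠ 0)) hc hn
  obtain ⟨i, j, hij, rfl⟩ := Finset.card_eq_two.mp ht2
  refine ⟨i, j, hij, fun k hki hkj => ?_⟩
  by_contra hk
  have := ht (Finset.mem_filter.mpr ⟨Finset.mem_univ k, hk⟩)
  simp [hki, hkj] at this

lemma Matrix.IsHermitian.exists_isometry (hH : H.IsHermitian) (hr : H.rank ≤ 2)
    (hn : 2 ≤ Fintype.card n) :
    ∃ U : Matrix n (Fin 2) ℂ, Uᴴ * U = 1 ∧ U * Uᴴ * H = H := by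
  obtain ⟨i, j, hij, hk⟩ := hH.exists_pair_eigenvalues hr hn
  set W : Matrix n n ℂ := (hH.eigenvectorUnitary : Matrix n n ℂ) with hW
  have hWW : Wᴴ * W = 1 := Unitary.coe_star_mul_self hH.eigenvectorUnitary
  have hf : Function.Injective ![i, j] := by
    intro a b
    fin_cases a <;> fin_cases b <;> simp [hij, hij.symm]
  have hUW : (W.submatrix id ![i, j])ᴴ * W = (1 : Matrix n n ℂ).submatrix ![i, j] id := by
    rw [← hWW]; rfl
  refine ⟨W.submatrix id ![i, j], ?_, ?_⟩
  · have : (W.submatrix id ![i, j])ᴴ * W.submatrix id ![i, j] =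
        (Wᴴ * W).submatrix ![i, j] ![i, j] := rfl
    rw [this, hWW, submatrix_one _ hf]
  · have hs : H = W * diagonal (RCLike.ofReal ∘ hH.eigenvalues) * Wᴴ := by
      conv_lhs => rw [hH.spectral_theorem]
      rfl
    have key : W.submatrix id ![i, j] * (W.submatrix id ![i, j])ᴴ * W *
        diagonal (RCLike.ofReal ∘ hH.eigenvalues) =
        W * diagonal (RCLike.ofReal ∘ hH.eigenvalues) := by
      ext x k
      rw [mul_diagonal, mul_diagonal, Matrix.mul_assoc, hUW]
      by_cases hki : k = i
      · subst hki
        rw [mul_apply, Fin.sum_univ_two]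
        simp [one_apply, hij.symm]
      by_cases hkj : k = j
      · subst hkj
        rw [mul_apply, Fin.sum_univ_two]
        simp [one_apply, hij]
      · simp [hk k hki hkj]
    conv_lhs => rw [hs]
    rw [← Matrix.mul_assoc, ← Matrix.mul_assoc, key, ← hs]

lemma Matrix.IsHermitian.trace_mul_self (hH : H.IsHermitian) :
    (H * H).trace = ∑ i, ((hH.eigenvalues i ^ 2 : ℝ) : ℂ) := by
  have hWW : (hH.eigenvectorUnitary : Matrix n n ℂ)ᴴ * hH.eigenvectorUnitary = 1 :=
    Unitary.coe_star_mul_self hH.eigenvectorUnitary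
  set W : Matrix n n ℂ := (hH.eigenvectorUnitary : Matrix n n ℂ) with hW
  set D : Matrix n n ℂ := diagonal (RCLike.ofReal ∘ hH.eigenvalues) with hD
  have hs : H = W * D * Wᴴ := by
    conv_lhs => rw [hH.spectral_theorem]
    rfl
  have : H * H = W * (D * D) * Wᴴ := by
    calc H * H = W * D * (Wᴴ * W) * D * Wᴴ := by
          conv_lhs => rw [hs]
          simp only [Matrix.mul_assoc]
      _ = _ := by rw [hWW]; simp only [Matrix.mul_assoc, Matrix.one_mul]
  rw [this, trace_mul_comm, ← Matrix.mul_assoc, hWW, Matrix.one_mul, hD, diagonal_mul_diagonal,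
    trace_diagonal]
  simp [sq]

/-- The largest eigenvalue of a state of rank at most two is determined by its purity. -/
lemma Matrix.PosSemidef.exists_lamMax_eq (hH : H.PosSemidef) (hr : H.rank ≤ 2)
    (hn : 2 ≤ Fintype.card n) (ht : H.trace = 1) :
    ∃ μ : ℝ, lamMax H = μ ∧ 1 / 2 ≤ μ ∧ μ ≤ 1 ∧ (H * H).trace.re = μ ^ 2 + (1 - μ) ^ 2 := by
  obtain ⟨i, j, hij, hk⟩ := hH.1.exists_pair_eigenvalues hr hn
  have hsum : ∀ f : n → ℝ, (∀ k, hH.1.eigenvalues k = 0 → f k = 0) → ∑ k, f k = f i + f j := by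
    intro f hf
    rw [← Finset.sum_pair hij]
    refine (Finset.sum_subset (Finset.subset_univ _) fun k _ h => hf k (hk k ?_ ?_)).symm <;>
    · rintro rfl
      simp at h
  have h1 : hH.1.eigenvalues i + hH.1.eigenvalues j = 1 := by
    rw [← hsum _ fun _ h => h]
    have := hH.1.trace_eq_sum_eigenvalues
    rw [ht] at this
    have h2 := congrArg Complex.re this
    simpa using h2.symm
  have h2 : (H * H).trace.re = hH.1.eigenvalues i ^ 2 + hH.1.eigenvalues j ^ 2 := by
    rw [← hsum (fun k => hH.1.eigenvalues k ^ 2) fun k h => by simp [h], hH.1.trace_mul_self,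
      ← Complex.ofReal_sum, Complex.ofReal_re]
  have hi := hH.eigenvalues_nonneg i
  have hj := hH.eigenvalues_nonneg j
  have hmax : lamMax H = max (hH.1.eigenvalues i) (hH.1.eigenvalues j) := by
    have hset : {x : ℝ | (x : ℂ) ∈ spectrum ℂ H} = Set.range hH.1.eigenvalues := by
      ext x
      simp [hH.1.spectrum_eq_image_range]
    rw [lamMax, hset]
    refine IsGreatest.csSup_eq ⟨?_, ?_⟩
    · rcases max_choice (hH.1.eigenvalues i) (hH.1.eigenvalues j) with h | h <;> rw [h] <;>
        exact Set.mem_range_self _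
    · rintro _ ⟨k, rfl⟩
      by_cases hki : k = i
      · exact hki ▸ le_max_left _ _
      by_cases hkj : k = j
      · exact hkj ▸ le_max_right _ _
      · rw [hk k hki hkj]
        exact hi.trans (le_max_left _ _)
  refine ⟨_, hmax, ?_, ?_, ?_⟩
  · rcases max_cases (hH.1.eigenvalues i) (hH.1.eigenvalues j) with h | h <;> linarith
  · exact max_le (by linarith) (by linarith)
  · rw [h2]
    rcases max_choice (hH.1.eigenvalues i) (hH.1.eigenvalues j) with h | h <;> rw [h]
    · rw [← h1]; ring
    · rw [← h1]; ring

end Spectral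
/-- The Gram matrix of the isometry with blocks `L`. -/
def gramK {ι : Type*} [Fintype ι] (L : ι → Matrix (Fin 2) (Fin 2) ℂ) : Matrix (Fin 2) (Fin 2) ℂ :=
  ∑ s, (L s)ᴴ * L s

/-- The Gram matrix of the blocks `L` for the Hilbert-Schmidt inner product. -/
def gramB {ι : Type*} (L : ι → Matrix (Fin 2) (Fin 2) ℂ) : Matrix ι ι ℂ :=
  of fun s t => (L s * (L t)ᴴ).trace

lemma exists_eq_vecMulVec_of_det_eq_zero {N : Matrix (Fin 2) (Fin 2) ℂ} (h : N.det = 0) :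
    ∃ α β : Fin 2 → ℂ, N = vecMulVec α β := by
  rw [det_fin_two] at h
  by_cases h00 : N 0 0 = 0
  · by_cases h01 : N 0 1 = 0
    · refine ⟨![0, 1], N 1, ?_⟩
      ext i j
      fin_cases i <;> fin_cases j <;> simp [vecMulVec_apply, h00, h01]
    · refine ⟨![1, N 1 1 / N 0 1], N 0, ?_⟩
      ext i j
      fin_cases i <;> fin_cases j <;> simp [vecMulVec_apply, h01]
      field_simp
      linear_combination -h
  · refine ⟨![1, N 1 0 / N 0 0], N 0, ?_⟩
    ext i j
    fin_cases i <;> fin_cases j <;> simp [vecMulVec_apply, h00]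
    field_simp
    linear_combination h

/-- The quantity whose sign decides the existence of an extension. -/
def defect (α β : Fin 2 → ℂ) : ℂ :=
  1 + (α ⬝ᵥ β) * star (α ⬝ᵥ β) - (α ⬝ᵥ star α) * (β ⬝ᵥ star β)

lemma det_gramK_sub_det_gramB_of_eq_mul {L : Fin 2 → Matrix (Fin 2) (Fin 2) ℂ} {α β : Fin 2 → ℂ}
    (h : L 1 = L 0 * vecMulVec α β) :
    (gramK L).det - (gramB L).det = ((L 0).det * star (L 0).det) * defect α β := by
  simp only [gramK, gramB, Fin.sum_univ_two, defect, det_fin_two, of_apply, h]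
  simp [trace_fin_two, mul_apply, vecMulVec_apply, dotProduct]
  ring

lemma det_gramK_sub_det_gramB_of_vecMulVec {L : Fin 2 → Matrix (Fin 2) (Fin 2) ℂ}
    {a b v w : Fin 2 → ℂ} (h0 : L 0 = vecMulVec a v) (h1 : L 1 = vecMulVec b w) :
    (gramK L).det - (gramB L).det =
      -(((a 0 * b 1 - a 1 * b 0) * star (a 0 * b 1 - a 1 * b 0)) *
        ((v ⬝ᵥ star w) * star (v ⬝ᵥ star w))) := by
  simp only [gramK, gramB, Fin.sum_univ_two, det_fin_two, of_apply, h0, h1]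
  simp [trace_fin_two, mul_apply, vecMulVec_apply, dotProduct]
  ring

lemma one_add_mul_star_pos (m : ℂ) : 0 < 1 + m * star m :=
  add_pos_of_pos_of_nonneg one_pos (mul_star_self_nonneg m)

lemma vecMulVec_mul_self (α β : Fin 2 → ℂ) :
    vecMulVec α β * vecMulVec α β = (α ⬝ᵥ β) • vecMulVec α β := by
  ext i j
  simp [mul_apply, vecMulVec_apply, dotProduct]
  ring

lemma defect_nonneg {α β : Fin 2 → ℂ} {T : Matrix (Fin 2) (Fin 2) ℂ} (hT : T.PosSemidef)
    (h : T + vecMulVec α β * T * (vecMulVec α β)ᴴ = 1) : 0 ≤ defect α β := by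
  set N := vecMulVec α β with hN
  set m := α ⬝ᵥ β with hm
  have hNN : N * N = m • N := vecMulVec_mul_self α β
  have hNN' : Nᴴ * Nᴴ = star m • Nᴴ := by
    rw [← conjTranspose_mul, hNN, conjTranspose_smul]
  have e1 : N * Nᴴ = (1 + m * star m) • (N * T * Nᴴ) := by
    have : N * (T + N * T * Nᴴ) * Nᴴ = N * T * Nᴴ + (N * N) * T * (Nᴴ * Nᴴ) := by noncomm_ring
    rw [h, hNN, hNN'] at this
    rw [mul_one] at this
    rw [this]
    simp only [smul_mul_assoc, mul_smul_comm, smul_smul, add_smul, one_smul]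
    rw [mul_comm (star m)]
  have e2 : (1 + m * star m) • T = (1 + m * star m) • 1 - N * Nᴴ := by
    rw [e1, ← h]; simp
  have e3 : (1 + m * star m) ^ 2 * T.det = (1 + m * star m) * defect α β := by
    have := congrArg det e2
    rw [det_smul] at this
    simp only [Fintype.card_fin] at this
    rw [this, defect, ← hm, hN]
    simp [det_fin_two, mul_apply, vecMulVec_apply, dotProduct]
    ring
  have hp := one_add_mul_star_pos m
  have e4 : defect α β = (1 + m * star m) * T.det := by
    apply mul_left_cancel₀ hp.ne'
    rw [← e3]; ring
  rw [e4]
  exact mul_nonneg hp.le hT.det_nonneg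

lemma exists_posSemidef_of_defect_nonneg {α β : Fin 2 → ℂ} (h : 0 ≤ defect α β) :
    ∃ T : Matrix (Fin 2) (Fin 2) ℂ, T.PosSemidef ∧
      T + vecMulVec α β * T * (vecMulVec α β)ᴴ = 1 := by
  set m := α ⬝ᵥ β with hm
  have hp := one_add_mul_star_pos m
  have hi : 0 ≤ (1 + m * star m)⁻¹ := by
    simpa using (inv_pos.mpr hp).le
  refine ⟨((1 + m * star m)⁻¹ * defect α β) • 1 + ((1 + m * star m)⁻¹ * (β ⬝ᵥ star β)) •
    vecMulVec ![star (α 1), -star (α 0)] (star ![star (α 1), -star (α 0)]), ?_, ?_⟩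
  · exact (PosSemidef.one.smul (mul_nonneg hi h)).add
      ((posSemidef_vecMulVec_self_star _).smul
        (mul_nonneg hi (dotProduct_self_star_nonneg _)))
  · have hne := hp.ne'
    have hE : vecMulVec ![star (α 1), -star (α 0)] (star ![star (α 1), -star (α 0)]) =
        !![star (α 1) * α 1, -(star (α 1) * α 0); -(star (α 0) * α 1), star (α 0) * α 0] := by
      ext i j
      fin_cases i <;> fin_cases j <;> simp [vecMulVec_apply]
    rw [hE]
    apply smul_right_injective _ hne
    simp only [smul_add, smul_smul, smul_mul_assoc, mul_smul_comm, mul_add, add_mul,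
      mul_inv_cancel_left₀ hne]
    rw [hm, defect]
    ext i j
    fin_cases i <;> fin_cases j <;>
      simp [mul_apply, vecMulVec_apply, dotProduct, Fin.sum_univ_two] <;> ring

lemma exists_mul_star_mul_eq_one {z : ℂ} (hz : 0 < z) : ∃ c : ℂ, c * star c * z = 1 := by
  obtain ⟨hre, him⟩ := Complex.pos_iff.mp hz
  refine ⟨((Real.sqrt z.re)⁻¹ : ℝ), ?_⟩
  have hz' : z = (z.re : ℂ) := Complex.ext rfl (by simp [him])
  rw [hz', Complex.star_def, Complex.conj_ofReal, ← Complex.ofReal_mul, ← Complex.ofReal_mul,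
    Complex.ofReal_re, ← mul_inv, Real.mul_self_sqrt hre.le, inv_mul_cancel₀ hre.ne',
    Complex.ofReal_one]

lemma exists_smul_eq_of_cross_eq_zero {a b : Fin 2 → ℂ} (h : a 0 * b 1 - a 1 * b 0 = 0) :
    ∃ (e : Fin 2 → ℂ) (x y : ℂ), a = x • e ∧ b = y • e := by
  by_cases h0 : a 0 = 0
  · by_cases h1 : a 1 = 0
    · refine ⟨b, 0, 1, ?_, by simp⟩
      ext i; fin_cases i <;> simp [h0, h1]
    · refine ⟨a, 1, b 1 / a 1, by simp, ?_⟩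
      ext i; fin_cases i <;> simp [h1]
      field_simp
      linear_combination -h
  · refine ⟨a, 1, b 0 / a 0, by simp, ?_⟩
    ext i; fin_cases i <;> simp [h0]
    field_simp
    linear_combination h

lemma exists_extension_of_product {ι : Type*} [Fintype ι] {L : ι → Matrix (Fin 2) (Fin 2) ℂ}
    {e : Fin 2 → ℂ}
    {w : ι → Fin 2 → ℂ} (hL : ∀ s, L s = vecMulVec e (w s))
    (hinj : ∀ x, (∀ s, L s *ᵥ x = 0) → x = 0) :
    ∃ Z : ι → Matrix (Fin 2) (Fin 2) ℂ, (∀ s t, L s * Z t = L t * Z s) ∧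
      ∑ t, Z t * (Z t)ᴴ = 1 := by
  have hpos : ∀ k, 0 < ∑ t, w t k * star (w t k) := by
    intro k
    have hnn : ∀ t ∈ Finset.univ, 0 ≤ w t k * star (w t k) := fun t _ => mul_star_self_nonneg _
    refine lt_of_le_of_ne (Finset.sum_nonneg hnn) fun h0 => ?_
    have hz := (Finset.sum_eq_zero_iff_of_nonneg hnn).mp h0.symm
    have : (Pi.single k 1 : Fin 2 → ℂ) = 0 := by
      apply hinj
      intro s
      have hs : w s k = 0 := by simpa using hz s (Finset.mem_univ _)
      rw [hL]
      ext i
      simp [vecMulVec_apply, hs]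
    simpa using congrFun this k
  choose c hc using fun k => exists_mul_star_mul_eq_one (hpos k)
  refine ⟨fun t => diagonal fun k => w t k * c k, fun s t => ?_, ?_⟩
  · ext i k
    simp only [hL, mul_diagonal, vecMulVec_apply]
    ring
  · simp only [diagonal_conjTranspose, diagonal_mul_diagonal]
    ext i j
    rw [Matrix.sum_apply]
    by_cases hij : i = j
    · subst hij
      simp only [diagonal_apply_eq, one_apply_eq, Pi.star_apply, star_mul']
      rw [← hc i, Finset.mul_sum]
      exact Finset.sum_congr rfl fun t _ => by ring
    · simp [hij]

lemma exists_extension_of_orthogonal {L : Fin 2 → Matrix (Fin 2) (Fin 2) ℂ}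
    {a b v w : Fin 2 → ℂ} (h0 : L 0 = vecMulVec a v) (h1 : L 1 = vecMulVec b w)
    (hinj : ∀ x, (∀ s, L s *ᵥ x = 0) → x = 0) (hvw : v ⬝ᵥ star w = 0) :
    ∃ Z : Fin 2 → Matrix (Fin 2) (Fin 2) ℂ, (∀ s t, L s * Z t = L t * Z s) ∧
      ∑ t, Z t * (Z t)ᴴ = 1 := by
  have key : ∀ s t, (∀ r, r = s ∨ r = t) → L s = 0 → (L t).det = 0 → False := by
    intro s t hst hs ht
    obtain ⟨x, hx, hx'⟩ := exists_mulVec_eq_zero_iff.mpr ht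
    refine hx (hinj x fun r => ?_)
    rcases hst r with rfl | rfl
    · simp [hs]
    · exact hx'
  have hv : v ≠ 0 := by
    rintro rfl
    exact key 0 1 (by decide) (by simp [h0]) (by simp [h1, det_vecMulVec])
  have hw : w ≠ 0 := by
    rintro rfl
    exact key 1 0 (by decide) (by simp [h1]) (by simp [h0, det_vecMulVec])
  obtain ⟨c, hc⟩ := exists_mul_star_mul_eq_one (dotProduct_self_star_pos_iff.mpr hv)
  obtain ⟨d, hd⟩ := exists_mul_star_mul_eq_one (dotProduct_self_star_pos_iff.mpr hw)
  have hvw' : w ⬝ᵥ star v = 0 := by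
    have := congrArg star hvw
    rwa [dotProduct_star, star_star, star_zero] at this
  refine ⟨![vecMulVec (star v) ![c, 0], vecMulVec (star w) ![0, d]], ?_, ?_⟩
  · intro s t
    fin_cases s <;> fin_cases t <;>
      simp only [h0, h1, vecMulVec_mul_vecMulVec, hvw, hvw', Fin.zero_eta, Fin.mk_one,
        cons_val_zero,
        cons_val_one, zero_smul, vecMulVec_zero]
  · have hQ : (!![star (v 0) * c, star (w 0) * d; star (v 1) * c, star (w 1) * d])ᴴ *
        !![star (v 0) * c, star (w 0) * d; star (v 1) * c, star (w 1) * d] = 1 := by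
      simp only [dotProduct, Fin.sum_univ_two, Pi.star_apply] at hc hd hvw hvw'
      ext i j
      fin_cases i <;> fin_cases j <;> simp [mul_apply] <;> simp only [← Complex.star_def]
      · linear_combination hc
      · linear_combination (star c * d) * hvw
      · linear_combination (star d * c) * hvw'
      · linear_combination hd
    rw [mul_eq_one_comm] at hQ
    rw [← hQ]
    ext i j
    fin_cases i <;> fin_cases j <;> simp [mul_apply]

/-- Two blocks, one of which is singular, admit an extension if the Gram determinants compare. -/
theorem exists_extension_of_det_le {L : Fin 2 → Matrix (Fin 2) (Fin 2) ℂ} (hdet : (L 1).det = 0)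
    (hinj : ∀ x, (∀ s, L s *ᵥ x = 0) → x = 0) (hle : 0 ≤ (gramK L).det - (gramB L).det) :
    ∃ Z : Fin 2 → Matrix (Fin 2) (Fin 2) ℂ, (∀ s t, L s * Z t = L t * Z s) ∧
      ∑ t, Z t * (Z t)ᴴ = 1 := by
  by_cases h0 : (L 0).det = 0
  · obtain ⟨a, v, hav⟩ := exists_eq_vecMulVec_of_det_eq_zero h0
    obtain ⟨b, w, hbw⟩ := exists_eq_vecMulVec_of_det_eq_zero hdet
    by_cases hvw : v ⬝ᵥ star w = 0
    · exact exists_extension_of_orthogonal hav hbw hinj hvw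
    · have hab : a 0 * b 1 - a 1 * b 0 = 0 := by
        rw [det_gramK_sub_det_gramB_of_vecMulVec hav hbw, neg_nonneg] at hle
        have := le_antisymm hle (mul_nonneg (mul_star_self_nonneg _) (mul_star_self_nonneg _))
        simpa only [mul_eq_zero, star_eq_zero, or_self, hvw, or_false] using this
      obtain ⟨e, x, y, rfl, rfl⟩ := exists_smul_eq_of_cross_eq_zero hab
      refine exists_extension_of_product (e := e) (w := ![x • v, y • w]) (fun s => ?_) hinj
      fin_cases s <;> simp [hav, hbw, smul_vecMulVec, vecMulVec_smul]
  · have hu : IsUnit (L 0).det := isUnit_iff_ne_zero.mpr h0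
    obtain ⟨α, β, hN⟩ := exists_eq_vecMulVec_of_det_eq_zero
      (N := (L 0)⁻¹ * L 1) (by rw [det_mul, hdet, mul_zero])
    have hL : L 1 = L 0 * vecMulVec α β := by rw [← hN, mul_nonsing_inv_cancel_left _ _ hu]
    rw [det_gramK_sub_det_gramB_of_eq_mul hL] at hle
    have hpos : 0 < (L 0).det * star (L 0).det :=
      lt_of_le_of_ne (mul_star_self_nonneg _) (mul_ne_zero h0 (star_ne_zero.mpr h0)).symm
    have hle' := mul_nonneg (inv_pos.mpr hpos).le hle
    rw [inv_mul_cancel_left₀ hpos.ne'] at hle'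
    obtain ⟨T, hT, hT1⟩ := exists_posSemidef_of_defect_nonneg hle'
    obtain ⟨B, rfl⟩ := hT.exists_eq_mul_conjTranspose
    refine ⟨![B, vecMulVec α β * B], fun s t => ?_, ?_⟩
    · fin_cases s <;> fin_cases t <;> simp [hL, Matrix.mul_assoc]
    · rw [← hT1]
      simp [Fin.sum_univ_two, Matrix.mul_assoc]

/-- Two blocks, one of which is singular, which admit an extension have comparable
Gram determinants. -/
theorem det_le_of_extension {J : Type*} [Fintype J] {L : Fin 2 → Matrix (Fin 2) (Fin 2) ℂ}
    (hdet : (L 1).det = 0) {Z : Fin 2 → Matrix (Fin 2) J ℂ} {τ : J → J}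
    (hsym : ∀ s t, L s * Z t = (L t * Z s).submatrix id τ) (hone : ∑ t, Z t * (Z t)ᴴ = 1) :
    0 ≤ (gramK L).det - (gramB L).det := by
  rw [Fin.sum_univ_two] at hone
  by_cases h0 : (L 0).det = 0
  · obtain ⟨a, v, hav⟩ := exists_eq_vecMulVec_of_det_eq_zero h0
    obtain ⟨b, w, hbw⟩ := exists_eq_vecMulVec_of_det_eq_zero hdet
    rw [det_gramK_sub_det_gramB_of_vecMulVec hav hbw]
    by_cases hab : a 0 * b 1 - a 1 * b 0 = 0
    · simp [hab]
    · have e1 : ∀ i j, a i * (v ᵥ* Z 1) j = b i * (w ᵥ* Z 0) (τ j) := by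
        intro i j
        have := congrFun (congrFun (hsym 0 1) i) j
        rw [hav, hbw, submatrix_apply, vecMulVec_mul, vecMulVec_mul] at this
        simpa [vecMulVec_apply] using this
      have e2 : ∀ i j, b i * (w ᵥ* Z 0) j = a i * (v ᵥ* Z 1) (τ j) := by
        intro i j
        have := congrFun (congrFun (hsym 1 0) i) j
        rw [hav, hbw, submatrix_apply, vecMulVec_mul, vecMulVec_mul] at this
        simpa [vecMulVec_apply] using this
      have z1 : v ᵥ* Z 1 = 0 := by
        ext j
        apply (mul_eq_zero_iff_left hab).mp
        linear_combination b 1 * e1 0 j - b 0 * e1 1 j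
      have z0 : w ᵥ* Z 0 = 0 := by
        ext j
        apply (mul_eq_zero_iff_left hab).mp
        linear_combination -a 1 * e2 0 j + a 0 * e2 1 j
      have hvw : v ⬝ᵥ star w = 0 := by
        have h2 : (Z 0)ᴴ *ᵥ star w = 0 := by rw [← star_vecMul, z0, star_zero]
        calc v ⬝ᵥ star w = v ⬝ᵥ ((Z 0 * (Z 0)ᴴ + Z 1 * (Z 1)ᴴ) *ᵥ star w) := by
              rw [hone, one_mulVec]
          _ = 0 := by
              rw [add_mulVec, dotProduct_add, ← mulVec_mulVec, ← mulVec_mulVec, h2,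
                dotProduct_mulVec v (Z 1), z1]
              simp
      simp [hvw]
  · have hu : IsUnit (L 0).det := isUnit_iff_ne_zero.mpr h0
    obtain ⟨α, β, hN⟩ := exists_eq_vecMulVec_of_det_eq_zero
      (N := (L 0)⁻¹ * L 1) (by rw [det_mul, hdet, mul_zero])
    have hL : L 1 = L 0 * vecMulVec α β := by rw [← hN, mul_nonsing_inv_cancel_left _ _ hu]
    rw [det_gramK_sub_det_gramB_of_eq_mul hL]
    have cancel : ∀ X Y : Matrix (Fin 2) J ℂ, L 0 * X = L 0 * Y → X = Y := fun X Y h => by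
      rw [← nonsing_inv_mul_cancel_left (L 0) X hu, h, nonsing_inv_mul_cancel_left (L 0) Y hu]
    have s0 : Z 0 = (Z 0).submatrix id τ := cancel _ _ (hsym 0 0)
    have s1 : Z 1 = vecMulVec α β * Z 0 := by
      apply cancel
      have h := hsym 0 1
      have h' : (L 1 * Z 0).submatrix id τ = L 1 * (Z 0).submatrix id τ := rfl
      rw [h, h', ← s0, hL, Matrix.mul_assoc]
    refine mul_nonneg (mul_star_self_nonneg _)
      (defect_nonneg (posSemidef_self_mul_conjTranspose (Z 0)) ?_)
    rw [← hone, s1]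
    simp [Matrix.mul_assoc]

section Blocks

/-- The matrix obtained by stacking the blocks `K b`. -/
def ofBlocks {A B k : Type*} (K : B → Matrix A k ℂ) : Matrix (A × B) k ℂ :=
  of fun p i => K p.2 p.1 i

lemma conjTranspose_ofBlocks_mul_ofBlocks {A B k : Type*} [Fintype A] [Fintype B]
    (K : B → Matrix A k ℂ) :
    (ofBlocks K)ᴴ * ofBlocks K = ∑ b, (K b)ᴴ * K b := by
  ext i j
  simp [ofBlocks, mul_apply, Matrix.sum_apply, Fintype.sum_prod_type_right]

lemma ofBlocks_mul_conjTranspose_apply {A B k : Type*} [Fintype k] (K : B → Matrix A k ℂ)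
    (a a' : A) (b b' : B) :
    (ofBlocks K * (ofBlocks K)ᴴ) (a, b) (a', b') = (K b * (K b')ᴴ) a a' := rfl

variable {A B J k : Type*} [Fintype A] [DecidableEq A] [Fintype B] [DecidableEq B] [Fintype J]
  [Fintype k] [DecidableEq k]

lemma Matrix.PosSemidef.exists_ofBlocks {ρ : Matrix (A × B) (A × B) ℂ} (hρ : ρ.PosSemidef)
    (hr : ρ.rank = 2) : ∃ K : B → Matrix A (Fin 2) ℂ, ρ = ofBlocks K * (ofBlocks K)ᴴ ∧
      ∀ x, (∀ b, K b *ᵥ x = 0) → x = 0 := by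
  obtain ⟨U, -, hU⟩ := hρ.1.exists_isometry hr.le (hr ▸ rank_le_card_width ρ)
  obtain ⟨C, hC⟩ := (hρ.conjTranspose_mul_mul_same U).exists_eq_mul_conjTranspose
  have hV : ρ = (U * C) * (U * C)ᴴ := by
    have h2 : ρ * (U * Uᴴ) = ρ := by
      have := congrArg Matrix.conjTranspose hU
      simpa [hρ.1.eq, Matrix.mul_assoc] using this
    calc ρ = U * (Uᴴ * ρ * U) * Uᴴ := by
          conv_lhs => rw [← h2, ← hU]
          simp only [Matrix.mul_assoc]
      _ = _ := by rw [hC, conjTranspose_mul]; simp only [Matrix.mul_assoc]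
  refine ⟨fun b => of fun a i => (U * C) (a, b) i, hV, fun x hx => ?_⟩
  have hrV : (U * C).rank = 2 := by
    rw [← rank_self_mul_conjTranspose, ← hV, hr]
  have hker : LinearMap.ker (U * C).mulVecLin = ⊥ := by
    rw [← Submodule.finrank_eq_zero (R := ℂ)]
    have := (U * C).mulVecLin.finrank_range_add_finrank_ker
    rw [Matrix.rank] at hrV
    simp at this
    omega
  rw [← Submodule.mem_bot ℂ, ← hker, LinearMap.mem_ker, mulVecLin_apply]
  ext ⟨a, b⟩
  exact congrFun (hx b) a

lemma exists_isSymExt_of_blocks {K : B → Matrix A k ℂ} {Z : B → Matrix k J ℂ}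
    (hsym : ∀ b c, K b * Z c = K c * Z b) (hone : ∑ c, Z c * (Z c)ᴴ = 1)
    (htr : (ofBlocks K * (ofBlocks K)ᴴ).trace = 1) :
    ∃ σ, IsSymExt (ofBlocks K * (ofBlocks K)ᴴ) σ := by
  set W : Matrix (A × B × B) J ℂ := of fun p j => (K p.2.1 * Z p.2.2) p.1 j with hW
  have happ : ∀ a b c a' b' c', (W * Wᴴ) (a, b, c) (a', b', c') =
      (K b * Z c * (K b' * Z c')ᴴ) a a' := fun _ _ _ _ _ _ => rfl
  have hpt : ∀ a a' b b', ∑ c, (W * Wᴴ) (a, b, c) (a', b', c) =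
      (ofBlocks K * (ofBlocks K)ᴴ) (a, b) (a', b') := by
    intro a a' b b'
    have : ∑ c, K b * Z c * (K b' * Z c)ᴴ = K b * (K b')ᴴ := by
      calc ∑ c, K b * Z c * (K b' * Z c)ᴴ = K b * (∑ c, Z c * (Z c)ᴴ) * (K b')ᴴ := by
            rw [Matrix.mul_sum, Matrix.sum_mul]
            simp only [conjTranspose_mul, Matrix.mul_assoc]
        _ = _ := by rw [hone, Matrix.mul_one]
    rw [ofBlocks_mul_conjTranspose_apply, ← this, Matrix.sum_apply]
    exact Finset.sum_congr rfl fun c _ => happ ..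
  refine ⟨W * Wᴴ, posSemidef_self_mul_conjTranspose W, ?_, hpt, ?_⟩
  · rw [← htr]
    simp only [trace, diag_apply, Fintype.sum_prod_type, ← hpt]
  · intro a b₁ b₂ a' b₁' b₂'
    rw [happ, happ, hsym b₁, hsym b₁']

lemma exists_blocks_of_isSymExt {K : B → Matrix A k ℂ}
    (hinj : ∀ x, (∀ b, K b *ᵥ x = 0) → x = 0)
    {σ : Matrix (A × B × B) (A × B × B) ℂ} (hσ : IsSymExt (ofBlocks K * (ofBlocks K)ᴴ) σ) :
    ∃ (τ : (A × B × B) × Bool → (A × B × B) × Bool) (Z : B → Matrix k ((A × B × B) × Bool) ℂ),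
      (∀ b c, K b * Z c = (K c * Z b).submatrix id τ) ∧ ∑ c, Z c * (Z c)ᴴ = 1 := by
  obtain ⟨hpos, -, hpt, hswap⟩ := hσ
  obtain ⟨W₀, hW₀⟩ := hpos.exists_eq_mul_conjTranspose
  set V := ofBlocks K with hV
  have hdet : IsUnit (Vᴴ * V).det := by
    refine ((Matrix.isUnit_iff_isUnit_det _).mp (PosDef.conjTranspose_mul_self V ?_).isUnit)
    intro x y hxy
    rw [← sub_eq_zero]
    refine hinj _ fun b => funext fun a => ?_
    have := congrFun hxy (a, b)
    rw [mulVec_sub, Pi.sub_apply, Pi.zero_apply, sub_eq_zero]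
    exact this
  have hl : (Vᴴ * V)⁻¹ * Vᴴ * V = 1 := by
    rw [Matrix.mul_assoc, nonsing_inv_mul _ hdet]
  set Vl := (Vᴴ * V)⁻¹ * Vᴴ
  obtain ⟨r, hr⟩ : ∃ r : ℂ, r * star r = 1 / 2 := by
    obtain ⟨c, hc⟩ := exists_mul_star_mul_eq_one (z := 2) (by norm_num)
    exact ⟨c, by rw [eq_div_iff two_ne_zero, hc]⟩
  set W : Matrix (A × B) (B × (A × B × B) × Bool) ℂ := of fun p q =>
    r * bif q.2.2 then W₀ (p.1, q.1, p.2) q.2.1 else W₀ (p.1, p.2, q.1) q.2.1 with hW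
  have hWW : W * Wᴴ = V * Vᴴ := by
    ext ⟨a, b⟩ ⟨a', b'⟩
    rw [← hpt, mul_apply, Fintype.sum_prod_type]
    refine Finset.sum_congr rfl fun c _ => ?_
    have h1 : ∀ p p', ∑ j, (r * W₀ p j) * star (r * W₀ p' j) = 1 / 2 * σ p p' := by
      intro p p'
      rw [hW₀, mul_apply, Finset.mul_sum]
      refine Finset.sum_congr rfl fun j _ => ?_
      rw [conjTranspose_apply, star_mul, ← hr]
      ring
    rw [Fintype.sum_prod_type_right, Fintype.sum_bool]
    simp only [hW, conjTranspose_apply, of_apply, cond_true, cond_false]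
    rw [h1, h1, ← hswap]
    ring
  have hP : W = V * (Vl * W) := by
    have h0 : ((1 - V * Vl) * W) * ((1 - V * Vl) * W)ᴴ = 0 := by
      have hz : (1 - V * Vl) * V = 0 := by
        rw [Matrix.sub_mul, Matrix.one_mul, Matrix.mul_assoc, hl, Matrix.mul_one, sub_self]
      rw [conjTranspose_mul, Matrix.mul_assoc, ← Matrix.mul_assoc W, hWW, ← Matrix.mul_assoc,
        ← Matrix.mul_assoc, hz, Matrix.zero_mul, Matrix.zero_mul]
    rw [self_mul_conjTranspose_eq_zero, Matrix.sub_mul, Matrix.one_mul, sub_eq_zero,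
      Matrix.mul_assoc] at h0
    exact h0
  refine ⟨Prod.map id not, fun c => (Vl * W).submatrix id (Prod.mk c), fun b c => ?_, ?_⟩
  · have hKZ : ∀ b c, K b * (Vl * W).submatrix id (Prod.mk c) =
        of fun a j => W (a, b) (c, j) := by
      intro b c
      ext a j
      exact (congrFun (congrFun hP (a, b)) (c, j)).symm
    rw [hKZ, hKZ]
    ext a ⟨j, t⟩
    cases t <;> simp [hW]
  · have : ∑ c, (Vl * W).submatrix id (Prod.mk c) * ((Vl * W).submatrix id (Prod.mk c))ᴴ =
        Vl * W * (Vl * W)ᴴ := by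
      ext i j
      rw [Matrix.sum_apply, mul_apply, Fintype.sum_prod_type]
      rfl
    rw [this, conjTranspose_mul, Matrix.mul_assoc, ← Matrix.mul_assoc W, hWW, Matrix.mul_assoc V,
      ← Matrix.mul_assoc, hl, Matrix.one_mul, ← conjTranspose_mul, hl, conjTranspose_one]

end Blocks

section ReducedRank

lemma exists_eq_smul_of_forall_cross_eq_zero {ι : Type*} {v : ι → Fin 2 → ℂ}
    (h : ∀ i j, v i 0 * v j 1 - v i 1 * v j 0 = 0) :
    ∃ (y : ι → ℂ) (e : Fin 2 → ℂ), ∀ i, v i = y i • e := by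
  by_cases h0 : ∀ i, v i = 0
  · exact ⟨0, 0, by simpa using h0⟩
  push Not at h0
  obtain ⟨j, hj⟩ := h0
  have : ∀ i, ∃ y : ℂ, v i = y • v j := by
    intro i
    by_cases hj0 : v j 0 = 0
    · have hj1 : v j 1 ≠ 0 := fun hj1 => hj (by ext s; fin_cases s <;> assumption)
      refine ⟨v i 1 / v j 1, ?_⟩
      ext s; fin_cases s <;> simp [hj1]
      field_simp
      linear_combination h i j
    · refine ⟨v i 0 / v j 0, ?_⟩
      ext s; fin_cases s <;> simp [hj0]
      field_simp
      linear_combination -h i j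
  choose y hy using this
  exact ⟨y, v j, hy⟩

variable {B J : Type*} [Fintype B] [Fintype J]
  {K : B → Matrix (Fin 2) (Fin 2) ℂ}

lemma rank_gramB_le_two_of_mul_eq {X : Matrix (Fin 2) (Fin 2) ℂ} (hX : X.det ≠ 0)
    (Y : Matrix B (Fin 2) ℂ) (C : Fin 2 → Matrix (Fin 2) (Fin 2) ℂ)
    (h : ∀ b, K b * X = ∑ s, Y b s • C s) : (gramB K).rank ≤ 2 := by
  have hK : ∀ b, K b = ∑ s, Y b s • (C s * X⁻¹) := by
    intro b
    rw [← Matrix.mul_one (K b), ← mul_nonsing_inv X (isUnit_iff_ne_zero.mpr hX), ← Matrix.mul_assoc,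
      h, Matrix.sum_mul]
    simp
  have hG : gramB K = Y * of fun s b' => (C s * X⁻¹ * (K b')ᴴ).trace := by
    ext b b'
    rw [mul_apply]
    simp only [gramB, of_apply]
    conv_lhs => rw [hK b]
    simp [Matrix.add_mul, trace_add]
  rw [hG]
  exact (rank_mul_le_left _ _).trans ((rank_le_card_width Y).trans (by simp))

lemma rank_gramB_le_two_of_extension {Z : B → Matrix (Fin 2) J ℂ} {τ : J → J}
    (hsym : ∀ b c, K b * Z c = (K c * Z b).submatrix id τ) (hone : ∑ c, Z c * (Z c)ᴴ = 1) :
    (gramB K).rank ≤ 2 := by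
  have hcol : ∀ b c a j, ∑ i, K b a i * Z c i j = ∑ i, K c a i * Z b i (τ j) := fun b c a j => by
    have := congrFun (congrFun (hsym b c) a) j
    rwa [submatrix_apply, mul_apply, mul_apply] at this
  by_cases h1 : ∃ j c c', Z c 0 j * Z c' 1 j - Z c 1 j * Z c' 0 j ≠ 0
  · obtain ⟨j, c, c', h⟩ := h1
    refine rank_gramB_le_two_of_mul_eq (X := of fun i m => Z (![c, c'] m) i j) ?_
      (of fun b s => Z b s (τ j)) (fun s => of fun a m => K (![c, c'] m) a s) fun b => ?_
    · rw [det_fin_two]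
      simpa [mul_comm] using h
    · ext a m
      simp only [mul_apply, of_apply, Matrix.sum_apply, Matrix.smul_apply, smul_eq_mul, hcol b]
      exact Finset.sum_congr rfl fun _ _ => mul_comm _ _
  push Not at h1
  have h2 : ∃ p q : B × J, Z p.1 0 p.2 * Z q.1 1 q.2 - Z p.1 1 p.2 * Z q.1 0 q.2 ≠ 0 := by
    by_contra! hc
    obtain ⟨y, e, hy⟩ := exists_eq_smul_of_forall_cross_eq_zero
      (v := fun (p : B × J) i => Z p.1 i p.2) hc
    have hZ : ∀ c i j, Z c i j = y (c, j) * e i := fun c i j => congrFun (hy (c, j)) i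
    have hone' : (1 : Matrix (Fin 2) (Fin 2) ℂ) =
        (∑ c, ∑ j, y (c, j) * star (y (c, j))) • vecMulVec e (star e) := by
      rw [← hone]
      ext i i'
      simp only [Matrix.sum_apply, mul_apply, conjTranspose_apply, hZ, Matrix.smul_apply,
        smul_eq_mul, vecMulVec_apply, Finset.sum_mul, Pi.star_apply, star_mul]
      exact Finset.sum_congr rfl fun _ _ => Finset.sum_congr rfl fun _ _ => by ring
    have := congrArg det hone'
    rw [det_one, det_smul, det_vecMulVec, mul_zero] at this
    exact one_ne_zero this
  obtain ⟨p, q, h⟩ := h2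
  choose y e hy using fun j => exists_eq_smul_of_forall_cross_eq_zero
    (v := fun c i => Z c i j) (h1 j)
  have hZ : ∀ c i j, Z c i j = y j c * e j i := fun c i j => congrFun (hy j c) i
  refine rank_gramB_le_two_of_mul_eq (X := of fun i m => Z (![p, q] m).1 i (![p, q] m).2) ?_
    (of fun b s => y (τ (![p, q] s).2) b) (fun s => of fun a m =>
      if m = s then ∑ i, K (![p, q] m).1 a i * e (τ (![p, q] m).2) i else 0) fun b => ?_
  · rw [det_fin_two]
    simpa [mul_comm] using h
  · ext a m
    simp only [mul_apply, of_apply, Matrix.sum_apply, Matrix.smul_apply, smul_eq_mul, hcol b,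
      mul_ite, mul_zero, Finset.sum_ite_eq, Finset.mem_univ, if_true, Finset.mul_sum]
    refine Finset.sum_congr rfl fun i _ => ?_
    rw [hZ b]
    ring

end ReducedRank

section NormalForm

lemma exists_root_of_binary_quadratic (p q r : ℂ) :
    ∃ x y : ℂ, (x ≠ 0 ∨ y ≠ 0) ∧ p * x ^ 2 + q * x * y + r * y ^ 2 = 0 := by
  by_cases hp : p = 0
  · exact ⟨1, 0, by simp, by simp [hp]⟩
  · obtain ⟨s, hs⟩ := IsAlgClosed.exists_pow_nat_eq (q ^ 2 - 4 * p * r) two_pos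
    refine ⟨(-q + s) / (2 * p), 1, by simp, ?_⟩
    field_simp
    linear_combination hs

lemma exists_unitary_det_eq_zero (L : Fin 2 → Matrix (Fin 2) (Fin 2) ℂ) :
    ∃ R : Matrix (Fin 2) (Fin 2) ℂ, Rᴴ * R = 1 ∧ (∑ t, star (R t 1) • L t).det = 0 := by
  obtain ⟨x, y, hxy, h⟩ := exists_root_of_binary_quadratic (L 0).det
    (L 0 0 0 * L 1 1 1 + L 1 0 0 * L 0 1 1 - L 0 0 1 * L 1 1 0 - L 1 0 1 * L 0 1 0) (L 1).det
  have hpos : 0 < x * star x + y * star y := by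
    have hx := mul_star_self_nonneg x
    have hy := mul_star_self_nonneg y
    rcases hxy with h0 | h0
    · exact add_pos_of_pos_of_nonneg (lt_of_le_of_ne hx
        (mul_ne_zero h0 (star_ne_zero.mpr h0)).symm) hy
    · exact add_pos_of_nonneg_of_pos hx (lt_of_le_of_ne hy
        (mul_ne_zero h0 (star_ne_zero.mpr h0)).symm)
  obtain ⟨c, hc⟩ := exists_mul_star_mul_eq_one hpos
  refine ⟨!![c * y, star (c * x); -(c * x), star (c * y)], ?_, ?_⟩
  · ext i j
    fin_cases i <;> fin_cases j <;> simp [mul_apply, Fin.sum_univ_two] <;>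
      simp only [Complex.star_def] at hc
    · linear_combination hc
    · ring
    · ring
    · linear_combination hc
  · rw [det_fin_two] at h ⊢
    rw [det_fin_two] at h
    simp [Fin.sum_univ_two]
    linear_combination c ^ 2 * h

lemma gramB_eq_mul_conjTranspose {B : Type*} {K : B → Matrix (Fin 2) (Fin 2) ℂ} : gramB K =
    (of fun b p => K b p.1 p.2 : Matrix B (Fin 2 × Fin 2) ℂ) *
      (of fun b p => K b p.1 p.2 : Matrix B (Fin 2 × Fin 2) ℂ)ᴴ := by
  ext b b'
  simp [gramB, trace, mul_apply, Fintype.sum_prod_type]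

variable {B : Type*} [Fintype B] {K : B → Matrix (Fin 2) (Fin 2) ℂ}

lemma posSemidef_gramB : (gramB K).PosSemidef :=
  gramB_eq_mul_conjTranspose (K := K) ▸ posSemidef_self_mul_conjTranspose _

/-- Blocks whose Gram matrix has rank at most two are isometric combinations of two matrices, one
of which may be taken singular. -/
lemma exists_isometry_of_rank_gramB_le_two [DecidableEq B] (hr : (gramB K).rank ≤ 2)
    (hB : 2 ≤ Fintype.card B) :
    ∃ U : Matrix B (Fin 2) ℂ, Uᴴ * U = 1 ∧ (∑ b, star (U b 1) • K b).det = 0 ∧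
      ∀ b, K b = ∑ s, U b s • ∑ c, star (U c s) • K c := by
  set κ : Matrix B (Fin 2 × Fin 2) ℂ := of fun b p => K b p.1 p.2
  have hG : gramB K = κ * κᴴ := gramB_eq_mul_conjTranspose
  have hH : (gramB K).IsHermitian := hG ▸ isHermitian_mul_conjTranspose_self κ
  obtain ⟨U, hU, hUG⟩ := hH.exists_isometry hr hB
  have hUκ : U * Uᴴ * κ = κ := by
    rw [hG, ← sub_eq_zero, ← Matrix.one_mul (κ * κᴴ), ← Matrix.mul_assoc _ 1, Matrix.mul_one,
      ← Matrix.sub_mul, mul_self_mul_conjTranspose_eq_zero, Matrix.sub_mul, Matrix.one_mul,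
      sub_eq_zero] at hUG
    exact hUG
  obtain ⟨R, hR, hdet⟩ := exists_unitary_det_eq_zero fun s => ∑ c, star (U c s) • K c
  have hR' : R * Rᴴ = 1 := mul_eq_one_comm.mp hR
  refine ⟨U * R, ?_, ?_, ?_⟩
  · rw [conjTranspose_mul, Matrix.mul_assoc, ← Matrix.mul_assoc Uᴴ, hU, Matrix.one_mul, hR]
  · rw [← hdet]
    congr 1
    simp only [mul_apply, star_sum, star_mul, Finset.sum_smul, Finset.smul_sum, smul_smul]
    rw [Finset.sum_comm]
  · intro b
    have : U * R * (U * R)ᴴ * κ = κ := by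
      rw [conjTranspose_mul, Matrix.mul_assoc U, ← Matrix.mul_assoc R, hR', Matrix.one_mul, hUκ]
    ext i j
    have h := congrFun (congrFun this b) (i, j)
    rw [Matrix.mul_assoc] at h
    simp only [mul_apply (M := U * R), mul_apply (M := (U * R)ᴴ)] at h
    simp only [Matrix.sum_apply, Matrix.smul_apply, smul_eq_mul]
    exact h.symm

end NormalForm

section Isometry

lemma gramB_sum_smul {B : Type*} (U : Matrix B (Fin 2) ℂ)
    (L : Fin 2 → Matrix (Fin 2) (Fin 2) ℂ) :
    gramB (fun b => ∑ s, U b s • L s) = U * gramB L * Uᴴ := by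
  rw [gramB_eq_mul_conjTranspose, gramB_eq_mul_conjTranspose]
  have : (of fun b p => (∑ s, U b s • L s) p.1 p.2 : Matrix B (Fin 2 × Fin 2) ℂ) =
      U * (of fun b p => L b p.1 p.2 : Matrix (Fin 2) (Fin 2 × Fin 2) ℂ) := by
    ext b p
    simp [mul_apply]
  rw [this, conjTranspose_mul]
  simp only [Matrix.mul_assoc]

variable {B : Type*} [Fintype B] {U : Matrix B (Fin 2) ℂ}

lemma sum_star_sum_mul_sum (hU : Uᴴ * U = 1) (x y : Fin 2 → ℂ) :
    ∑ b, star (∑ s, U b s * x s) * ∑ t, U b t * y t = ∑ s, star (x s) * y s := by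
  change star (U *ᵥ x) ⬝ᵥ (U *ᵥ y) = star x ⬝ᵥ y
  rw [star_mulVec, ← dotProduct_mulVec, mulVec_mulVec, hU, one_mulVec]

lemma sum_conjTranspose_sum_smul_mul {m n : Type*} [Fintype m] (hU : Uᴴ * U = 1)
    (X : Fin 2 → Matrix m n ℂ) :
    ∑ b, (∑ s, U b s • X s)ᴴ * ∑ s, U b s • X s = ∑ s, (X s)ᴴ * X s := by
  ext i j
  simp only [Matrix.sum_apply, mul_apply, conjTranspose_apply, Matrix.smul_apply, smul_eq_mul]
  rw [Finset.sum_comm, Finset.sum_comm (s := Finset.univ (α := Fin 2))]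
  exact Finset.sum_congr rfl fun k _ => sum_star_sum_mul_sum hU _ _

lemma sum_sum_smul_mul_conjTranspose {m n : Type*} [Fintype n] (hU : Uᴴ * U = 1)
    (X : Fin 2 → Matrix m n ℂ) :
    ∑ b, (∑ s, U b s • X s) * (∑ s, U b s • X s)ᴴ = ∑ s, X s * (X s)ᴴ := by
  ext i j
  simp only [Matrix.sum_apply, mul_apply, conjTranspose_apply, Matrix.smul_apply, smul_eq_mul]
  rw [Finset.sum_comm, Finset.sum_comm (s := Finset.univ (α := Fin 2))]
  simp only [mul_comm _ (star _)]
  exact Finset.sum_congr rfl fun k _ => sum_star_sum_mul_sum hU _ _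

end Isometry

section Purity

lemma trace_mul_self_fin_two (M : Matrix (Fin 2) (Fin 2) ℂ) :
    (M * M).trace = M.trace ^ 2 - 2 * M.det := by
  simp only [trace_fin_two, det_fin_two, mul_apply, Fin.sum_univ_two]
  ring

lemma trace_conj_isometry {B : Type*} [Fintype B] {U : Matrix B (Fin 2) ℂ} (hU : Uᴴ * U = 1)
    (M : Matrix (Fin 2) (Fin 2) ℂ) : (U * M * Uᴴ).trace = M.trace := by
  rw [trace_mul_comm, ← Matrix.mul_assoc, hU, Matrix.one_mul]

lemma lamMax_le_lamMax_iff {m n : Type*} [Fintype m] [DecidableEq m] [Fintype n] [DecidableEq n]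
    {M : Matrix m m ℂ} {N : Matrix n n ℂ} (hM : M.PosSemidef) (hN : N.PosSemidef)
    (hMr : M.rank ≤ 2) (hNr : N.rank ≤ 2) (hm : 2 ≤ Fintype.card m) (hn : 2 ≤ Fintype.card n)
    (hMt : M.trace = 1) (hNt : N.trace = 1) :
    lamMax M ≤ lamMax N ↔ (M * M).trace.re ≤ (N * N).trace.re := by
  obtain ⟨μ, h1, h2, -, h3⟩ := hM.exists_lamMax_eq hMr hm hMt
  obtain ⟨ν, h4, h5, -, h6⟩ := hN.exists_lamMax_eq hNr hn hNt
  rw [h1, h4, h3, h6]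
  constructor
  · intro h
    nlinarith
  · intro h
    by_contra! hlt
    nlinarith

lemma trace_gramB {ι : Type*} [Fintype ι] (K : ι → Matrix (Fin 2) (Fin 2) ℂ) :
    (gramB K).trace = (gramK K).trace := by
  simp only [gramK, trace_sum, trace_mul_comm (K _)ᴴ]
  rfl

lemma lamMax_le_lamMax_iff_det {B : Type*} [Fintype B] [DecidableEq B]
    {U : Matrix B (Fin 2) ℂ} (hU : Uᴴ * U = 1)
    {L : Fin 2 → Matrix (Fin 2) (Fin 2) ℂ} {K : B → Matrix (Fin 2) (Fin 2) ℂ}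
    (hK : ∀ b, K b = ∑ s, U b s • L s) (hB : 2 ≤ Fintype.card B)
    (htr : (ofBlocks K * (ofBlocks K)ᴴ).trace = 1) :
    lamMax (ofBlocks K * (ofBlocks K)ᴴ) ≤ lamMax (gramB K) ↔
      0 ≤ (gramK L).det - (gramB L).det := by
  have hKL : (ofBlocks K)ᴴ * ofBlocks K = gramK L := by
    rw [conjTranspose_ofBlocks_mul_ofBlocks, funext hK]
    exact sum_conjTranspose_sum_smul_mul hU L
  have hBL : gramB K = U * gramB L * Uᴴ := by rw [funext hK, gramB_sum_smul]
  have htG : (gramK L).trace = 1 := by rw [← hKL, trace_mul_comm, htr]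
  have htB : (gramB L).trace = 1 := by rw [trace_gramB, htG]
  have hp : (ofBlocks K * (ofBlocks K)ᴴ * (ofBlocks K * (ofBlocks K)ᴴ)).trace =
      (gramK L * gramK L).trace := by
    rw [← hKL, Matrix.mul_assoc, trace_mul_comm]
    simp only [Matrix.mul_assoc]
  have hq : (gramB K * gramB K).trace = (gramB L * gramB L).trace := by
    rw [← trace_conj_isometry hU (gramB L * gramB L), hBL]
    congr 1
    calc U * gramB L * Uᴴ * (U * gramB L * Uᴴ) = U * gramB L * (Uᴴ * U) * (gramB L * Uᴴ) := by
          simp only [Matrix.mul_assoc]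
      _ = _ := by rw [hU]; simp only [Matrix.mul_assoc, Matrix.one_mul]
  have hrV : (ofBlocks K * (ofBlocks K)ᴴ).rank ≤ 2 := by
    rw [rank_self_mul_conjTranspose]
    exact (rank_le_card_width _).trans (by simp)
  have hrB : (gramB K).rank ≤ 2 := by
    rw [hBL]
    exact ((rank_mul_le_left _ _).trans (rank_mul_le_left _ _)).trans
      ((rank_le_card_width _).trans (by simp))
  rw [lamMax_le_lamMax_iff (posSemidef_self_mul_conjTranspose _) posSemidef_gramB hrV hrB
    (by simp; omega) hB htr (by rw [hBL, trace_conj_isometry hU, htB]), hp, hq,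
    trace_mul_self_fin_two, trace_mul_self_fin_two, htG, htB]
  have hG : 0 ≤ (gramK L).det := by
    rw [← hKL]
    exact (posSemidef_conjTranspose_mul_self _).det_nonneg
  have hΓ : 0 ≤ (gramB L).det := posSemidef_gramB.det_nonneg
  rw [Complex.nonneg_iff] at hG hΓ ⊢
  simp only [one_pow, Complex.sub_re, Complex.sub_im, Complex.one_re, Complex.mul_re,
    Complex.re_ofNat, Complex.im_ofNat, zero_mul, ← hG.2,
    ← hΓ.2, sub_zero, and_true]
  constructor <;> intro h <;> linarith

end Purity

section Main

lemma sum_smul_mul_sum_smul {ι l m n : Type*} [Fintype ι] [Fintype m] (f g : ι → ℂ)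
    (M : ι → Matrix l m ℂ) (N : ι → Matrix m n ℂ) :
    (∑ b, f b • M b) * ∑ c, g c • N c = ∑ b, ∑ c, (f b * g c) • (M b * N c) := by
  rw [Matrix.sum_mul]
  refine Finset.sum_congr rfl fun b _ => ?_
  simp only [Matrix.mul_sum, Matrix.smul_mul, Matrix.mul_smul, smul_smul, mul_comm]

variable {B : Type*} [Fintype B] {K : B → Matrix (Fin 2) (Fin 2) ℂ}

lemma exists_extension_of_isometry {U : Matrix B (Fin 2) ℂ} {J : Type*} [Fintype J]
    {Z : B → Matrix (Fin 2) J ℂ} {τ : J → J} (hU : Uᴴ * U = 1)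
    (hK : ∀ b, K b = ∑ s, U b s • ∑ c, star (U c s) • K c)
    (hinj : ∀ x, (∀ b, K b *ᵥ x = 0) → x = 0)
    (hsym : ∀ b c, K b * Z c = (K c * Z b).submatrix id τ) (hone : ∑ c, Z c * (Z c)ᴴ = 1) :
    ∃ Z' : Fin 2 → Matrix (Fin 2) J ℂ,
      (∀ s t, (∑ c, star (U c s) • K c) * Z' t =
        ((∑ c, star (U c t) • K c) * Z' s).submatrix id τ) ∧ ∑ t, Z' t * (Z' t)ᴴ = 1 := by
  have hsub : ∀ (f : B → ℂ) (M : B → Matrix (Fin 2) J ℂ),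
      (∑ c, f c • M c).submatrix id τ = ∑ c, f c • (M c).submatrix id τ := by
    intro f M
    ext i j
    simp [Matrix.sum_apply]
  have hmul : ∀ (f g : B → ℂ), (∑ b, f b • K b) * ∑ c, g c • Z c =
      ((∑ c, g c • K c) * ∑ b, f b • Z b).submatrix id τ := by
    intro f g
    ext i j
    rw [sum_smul_mul_sum_smul, sum_smul_mul_sum_smul, Finset.sum_comm]
    simp only [Matrix.sum_apply, submatrix_apply, Matrix.smul_apply]
    refine Finset.sum_congr rfl fun c _ => Finset.sum_congr rfl fun b _ => ?_
    rw [hsym b c, mul_comm (f b)]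
    rfl
  refine ⟨fun s => ∑ c, star (U c s) • Z c, fun s t => hmul _ _, ?_⟩
  have hZ : ∀ c, Z c = ∑ s, U c s • ∑ d, star (U d s) • Z d := by
    intro c
    have h1 : ∀ M : B → Matrix (Fin 2) J ℂ, ∑ s, U c s • ∑ d, star (U d s) • M d =
        ∑ d, (∑ s, U c s * star (U d s)) • M d := by
      intro M
      simp only [Finset.smul_sum, Finset.sum_smul, smul_smul]
      exact Finset.sum_comm
    have h2 : ∀ b, K b * Z c = K b * ∑ s, U c s • ∑ d, star (U d s) • Z d := by
      intro b
      have h3 : K c = ∑ d, (∑ s, U c s * star (U d s)) • K d := by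
        rw [hK c]
        simp only [Finset.smul_sum, Finset.sum_smul, smul_smul]
        exact Finset.sum_comm
      rw [h1, hsym, h3, Matrix.sum_mul, Matrix.mul_sum]
      simp only [Matrix.smul_mul, Matrix.mul_smul, hsub, ← hsym]
    ext i j
    have h4 := hinj (fun i => (Z c - ∑ s, U c s • ∑ d, star (U d s) • Z d) i j) fun b => by
      have := sub_eq_zero.mpr (h2 b)
      rw [← Matrix.mul_sub] at this
      ext a
      exact congrFun (congrFun this a) j
    exact sub_eq_zero.mp (congrFun h4 i)
  rw [← sum_sum_smul_mul_conjTranspose hU, ← hone]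
  simp only [← hZ]

lemma exists_isSymExt_iff [DecidableEq B] (hB : 2 ≤ Fintype.card B)
    (hinj : ∀ x, (∀ b, K b *ᵥ x = 0) → x = 0)
    (htr : (ofBlocks K * (ofBlocks K)ᴴ).trace = 1) :
    (∃ σ, IsSymExt (ofBlocks K * (ofBlocks K)ᴴ) σ) ↔
      lamMax (ofBlocks K * (ofBlocks K)ᴴ) ≤ lamMax (gramB K) ∧ (gramB K).rank ≤ 2 := by
  constructor
  · rintro ⟨σ, hσ⟩
    obtain ⟨τ, Z, hsym, hone⟩ := exists_blocks_of_isSymExt hinj hσ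
    have hr := rank_gramB_le_two_of_extension hsym hone
    obtain ⟨U, hU, hdet, hK⟩ := exists_isometry_of_rank_gramB_le_two hr hB
    obtain ⟨Z', hsym', hone'⟩ := exists_extension_of_isometry hU hK hinj hsym hone
    exact ⟨(lamMax_le_lamMax_iff_det hU hK hB htr).mpr
      (det_le_of_extension (L := fun s => ∑ c, star (U c s) • K c) hdet hsym' hone'), hr⟩
  · rintro ⟨hle, hr⟩
    obtain ⟨U, hU, hdet, hK⟩ := exists_isometry_of_rank_gramB_le_two hr hB
    obtain ⟨Z, hsym, hone⟩ := exists_extension_of_det_le (L := fun s => ∑ c, star (U c s) • K c)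
      hdet (fun x hx => hinj x fun b => by
        rw [hK b, sum_mulVec]
        simp only [smul_mulVec, hx, smul_zero, Finset.sum_const_zero])
      ((lamMax_le_lamMax_iff_det hU hK hB htr).mp hle)
    refine exists_isSymExt_of_blocks (Z := fun c => ∑ t, U c t • Z t) (fun b c => ?_) ?_ htr
    · rw [hK b, hK c, sum_smul_mul_sum_smul, sum_smul_mul_sum_smul, Finset.sum_comm]
      refine Finset.sum_congr rfl fun t _ => Finset.sum_congr rfl fun s _ => ?_
      rw [hsym s t, mul_comm (U b s)]
    · rw [sum_sum_smul_mul_conjTranspose hU, hone]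

lemma exists_isSymExt_of_unique {A : Type*} [Fintype A] [DecidableEq A] [DecidableEq B] [Unique B]
    {ρ : Matrix (A × B) (A × B) ℂ} (hρ : ρ.PosSemidef) (htr : ρ.trace = 1) :
    ∃ σ, IsSymExt ρ σ := by
  refine ⟨ρ.submatrix (fun p => (p.1, p.2.1)) (fun p => (p.1, p.2.1)), hρ.submatrix _, ?_, ?_, ?_⟩
  · rw [← htr]
    simp [trace, Fintype.sum_prod_type]
  · intro a a' b b'
    simp
  · intro a b₁ b₂ a' b₁' b₂'
    simp [Subsingleton.elim b₁ b₂, Subsingleton.elim b₁' b₂']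

end Main

/-- Necessary and sufficient conditions for symmetric extension of a rank-2
state on `2 × dB`. -/
theorem stmt_16 (dB : ℕ)
    (ρ : Matrix (Fin 2 × Fin dB) (Fin 2 × Fin dB) ℂ)
    (hρ : ρ.PosSemidef) (hρtr : ρ.trace = 1) (hrank : ρ.rank = 2) :
    (∃ σ, IsSymExt ρ σ) ↔
      (lamMax ρ ≤ lamMax (reduceB ρ) ∧ (reduceB ρ).rank ≤ 2) := by
  obtain rfl | rfl | hB : dB = 0 ∨ dB = 1 ∨ 2 ≤ dB := by omega
  · simp [trace] at hρtr
  · have htr : (reduceB ρ).trace = 1 := by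
      rw [← hρtr]
      simp [trace, reduceB, Fintype.sum_prod_type]
    have hone : reduceB ρ = 1 := by
      ext i j
      rw [Subsingleton.elim j i, Subsingleton.elim i 0]
      simpa [trace] using htr
    refine iff_of_true (exists_isSymExt_of_unique hρ hρtr) ⟨?_, ?_⟩
    · obtain ⟨μ, h1, -, h2, -⟩ := hρ.exists_lamMax_eq hrank.le (by simp) hρtr
      have : lamMax (1 : Matrix (Fin 1) (Fin 1) ℂ) = 1 := by
        rw [lamMax, spectrum.one_eq]
        simp
      rw [hone, this, h1]
      exact h2
    · exact (rank_le_card_width _).trans (by simp)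
  · obtain ⟨K, rfl, hinj⟩ := hρ.exists_ofBlocks hrank
    exact exists_isSymExt_iff (by simpa) hinj hρtr
end
end

section
/- Let ρ be a bipartite state on A⊗B (dimensions dA, dB) that admits a symmetric extension and whose reduced state ρ_B satisfies rank(ρ_B) > rank(ρ). Then for every decomposition ρ = ∑_j p_j ρ_j into a finite convex combination (p_j > 0, ∑_j p_j = 1) of pure-extendible states ρ_j, every ρ_j satisfies rank(ρ_j) < rank(ρ). -/
open Matrix Kronecker ComplexOrder

noncomputable section

namespace Matrix

theorem exists_eq_vecMulVec_of_rank_eq_one {K m n : Type*} [Field K] [Fintype n]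
    [DecidableEq n] {M : Matrix m n K} (hM : M.rank = 1) :
    ∃ (u : m → K) (w : n → K), M = vecMulVec u w := by
  obtain ⟨⟨u, _⟩, _, hu⟩ := finrank_eq_one_iff'.1 hM
  choose w hw using fun j => hu ⟨M.mulVecLin (Pi.single j 1), LinearMap.mem_range_self _ _⟩
  refine ⟨u, w, ?_⟩
  ext i j
  have h := congrFun (congrArg Subtype.val (hw j)) i
  simp only [SetLike.mk_smul_mk, Pi.smul_apply, smul_eq_mul, mulVecLin_apply,
    mulVec_single_one, col_apply] at h
  rw [vecMulVec_apply, ← h, mul_comm]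

theorem IsHermitian.exists_eq_smul_vecMulVec_of_rank_eq_one {K n : Type*} [Field K] [StarRing K]
    [Fintype n] [DecidableEq n] {M : Matrix n n K} (hM : M.IsHermitian) (hr : M.rank = 1) :
    ∃ (c : K) (u : n → K), c ≠ 0 ∧ M = c • vecMulVec u (star u) := by
  obtain ⟨u, w, rfl⟩ := exists_eq_vecMulVec_of_rank_eq_one hr
  have hu : u ≠ 0 := by rintro rfl; simp at hr
  have hw : w ≠ 0 := by rintro rfl; simp at hr
  obtain ⟨i, hi⟩ := Function.ne_iff.1 hu
  rw [Pi.zero_apply] at hi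
  have hwu : w = (star (w i) / u i) • star u := by
    ext j
    have h := hM.apply i j
    simp only [vecMulVec_apply, star_mul'] at h
    simp only [Pi.smul_apply, smul_eq_mul, Pi.star_apply]
    field_simp
    linear_combination -h
  refine ⟨star (w i) / u i, u, ?_, ?_⟩
  · intro h
    exact hw (by rw [hwu, h, zero_smul])
  · rw [← vecMulVec_smul, ← hwu]

theorem rank_le_rank_of_ker_le {K m m' n : Type*} [Field K] [Fintype n]
    {M : Matrix m n K} {N : Matrix m' n K}
    (h : LinearMap.ker N.mulVecLin ≤ LinearMap.ker M.mulVecLin) : M.rank ≤ N.rank := by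
  have hM := M.mulVecLin.finrank_range_add_finrank_ker
  have hN := N.mulVecLin.finrank_range_add_finrank_ker
  have hle := Submodule.finrank_mono h
  simp only [rank]
  omega

theorem ker_eq_of_ker_le_of_rank_le {K m m' n : Type*} [Field K] [Fintype n]
    {M : Matrix m n K} {N : Matrix m' n K}
    (h : LinearMap.ker N.mulVecLin ≤ LinearMap.ker M.mulVecLin) (hr : N.rank ≤ M.rank) :
    LinearMap.ker N.mulVecLin = LinearMap.ker M.mulVecLin := by
  refine Submodule.eq_of_le_of_finrank_le h ?_
  have hM := M.mulVecLin.finrank_range_add_finrank_ker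
  have hN := N.mulVecLin.finrank_range_add_finrank_ker
  simp only [rank] at hr
  omega

theorem PosSemidef.mulVec_eq_zero_of_sum {𝕜 ι n : Type*} [RCLike 𝕜] [Fintype n]
    {s : Finset ι} {M : ι → Matrix n n 𝕜} (hM : ∀ i ∈ s, (M i).PosSemidef) {x : n → 𝕜}
    (hx : (∑ i ∈ s, M i) *ᵥ x = 0) {i : ι} (hi : i ∈ s) : M i *ᵥ x = 0 := by
  have h : ∑ i ∈ s, star x ⬝ᵥ M i *ᵥ x = 0 := by
    rw [← dotProduct_sum, ← sum_mulVec, hx, dotProduct_zero]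
  exact ((hM i hi).dotProduct_mulVec_zero_iff x).1
    ((Finset.sum_eq_zero_iff_of_nonneg fun i hi => (hM i hi).dotProduct_mulVec_nonneg x).1 h i hi)

end Matrix

section BipartiteState

variable {A B : Type*} [Fintype A]

theorem reduceB_eq_sum (ρ : Matrix (A × B) (A × B) ℂ) :
    reduceB ρ = ∑ a, ρ.submatrix (Prod.mk a) (Prod.mk a) := by
  ext b b'
  simp [reduceB, Matrix.sum_apply]

variable [DecidableEq A] [Fintype B]

theorem mulVec_single_tensor (ρ : Matrix (A × B) (A × B) ℂ) (a : A) (v : B → ℂ) (q : A × B) :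
    (ρ *ᵥ fun p => if p.1 = a then v p.2 else 0) q = ∑ b, ρ q (a, b) * v b := by
  simp [mulVec, dotProduct, Fintype.sum_prod_type_right]

theorem ker_reduceB_le {ρ τ : Matrix (A × B) (A × B) ℂ} (hτ : τ.PosSemidef)
    (h : LinearMap.ker τ.mulVecLin ≤ LinearMap.ker ρ.mulVecLin) :
    LinearMap.ker (reduceB τ).mulVecLin ≤ LinearMap.ker (reduceB ρ).mulVecLin := by
  intro v hv
  simp only [LinearMap.mem_ker, mulVecLin_apply, reduceB_eq_sum] at hv ⊢
  rw [sum_mulVec]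
  refine Finset.sum_eq_zero fun a ha => ?_
  have hva := Matrix.PosSemidef.mulVec_eq_zero_of_sum (fun a _ => hτ.submatrix (Prod.mk a)) hv ha
  have hτa : τ *ᵥ (fun p => if p.1 = a then v p.2 else 0) = 0 := by
    refine (hτ.dotProduct_mulVec_zero_iff _).1 ?_
    simp only [dotProduct, Fintype.sum_prod_type_right, mulVec_single_tensor]
    refine Finset.sum_eq_zero fun b _ => ?_
    have hb : ∑ b', τ (a, b) (a, b') * v b' = 0 := congrFun hva b
    simp [apply_ite star, ite_mul, hb]
  have hρa : ρ *ᵥ (fun p => if p.1 = a then v p.2 else 0) = 0 := h hτa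
  ext b
  exact (mulVec_single_tensor ρ a v (a, b)).symm.trans (congrFun hρa (a, b))

theorem PureExt.rank_reduceB [DecidableEq B] {ρ : Matrix (A × B) (A × B) ℂ} (hρ : PureExt ρ) :
    (reduceB ρ).rank = ρ.rank := by
  obtain ⟨σ, ⟨hσ, -, hpt, hswap⟩, hr⟩ := hρ
  obtain ⟨c, u, hc, rfl⟩ := hσ.isHermitian.exists_eq_smul_vecMulVec_of_rank_eq_one hr
  let M : Matrix (A × B) B ℂ := Matrix.of fun q b => u (q.1, q.2, b)
  have hρM : ρ = c • (M * Mᴴ) := by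
    ext ⟨a, b⟩ ⟨a', b'⟩
    rw [← hpt]
    simp [M, vecMulVec_apply, mul_apply, Finset.mul_sum]
  have hρB : reduceB ρ = c • (Mᴴ * M)ᵀ := by
    ext b b'
    simp only [reduceB, ← hpt]
    simp_rw [hswap _ b]
    simp [M, vecMulVec_apply, mul_apply, Finset.mul_sum, Fintype.sum_prod_type]
  rw [hρB, hρM, rank_smul_of_mem_nonZeroDivisors _ (mem_nonZeroDivisors_of_ne_zero hc),
    rank_smul_of_mem_nonZeroDivisors _ (mem_nonZeroDivisors_of_ne_zero hc), rank_transpose,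
    rank_conjTranspose_mul_self, rank_self_mul_conjTranspose]

end BipartiteState

/-- If `rank(ρ_B) > rank(ρ)` for a symmetric-extendible state, then every
decomposition into pure-extendible states uses only states of rank `< rank(ρ)`. -/
theorem stmt_17 (dA dB : ℕ)
    (ρ : Matrix (Fin dA × Fin dB) (Fin dA × Fin dB) ℂ)
    (hρ : ρ.PosSemidef) (hρtr : ρ.trace = 1)
    (hext : ∃ σ, IsSymExt ρ σ)
    (hrank : ρ.rank < (reduceB ρ).rank) :
    ∀ (n : ℕ) (p : Fin n → ℝ) (ρs : Fin n → Matrix (Fin dA × Fin dB) (Fin dA × Fin dB) ℂ),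
      (∀ j, 0 < p j) → (∑ j, p j = 1) →
      (∀ j, (ρs j).PosSemidef ∧ (ρs j).trace = 1 ∧ PureExt (ρs j)) →
      ρ = ∑ j, (p j : ℂ) • ρs j →
      ∀ j, (ρs j).rank < ρ.rank := by
  intro n p ρs hp _ hρs hsum j
  by_contra! hle
  have hker : LinearMap.ker ρ.mulVecLin ≤ LinearMap.ker (ρs j).mulVecLin := by
    intro x hx
    rw [LinearMap.mem_ker, mulVecLin_apply, hsum] at hx
    have hj := Matrix.PosSemidef.mulVec_eq_zero_of_sum (fun i _ => (hρs i).1.smul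
      (Complex.zero_le_real.2 (hp i).le)) hx (Finset.mem_univ j)
    rw [smul_mulVec] at hj
    exact (smul_eq_zero.1 hj).resolve_left (Complex.ofReal_ne_zero.2 (hp j).ne')
  have hker_eq := Matrix.ker_eq_of_ker_le_of_rank_le hker hle
  have hB := Matrix.rank_le_rank_of_ker_le (ker_reduceB_le (hρs j).1 hker_eq.ge)
  rw [(hρs j).2.2.rank_reduceB] at hB
  exact (hrank.trans_le hB).not_ge (Matrix.rank_le_rank_of_ker_le hker)
end
end

section
/- Let ρ be a bipartite state on A⊗B where B is a qubit (dB = 2) and A has arbitrary finite dimension dA. If ρ admits a symmetric extension, then ρ admits a bosonic extension, i.e., a symmetric extension σ additionally satisfying σ (a,b₁,b₂) (a',b₁',b₂') = σ (a,b₂,b₁) (a',b₁',b₂') for all indices (σ is supported on the symmetric subspace of the two B factors). -/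
open Matrix Kronecker ComplexOrder

noncomputable section

/-- Entries of the compression of `σ` by an operator acting on the second factor only. -/
lemma one_kronecker_conj_apply {A C : Type*} [Fintype A] [DecidableEq A] [Fintype C]
    (X : Matrix C C ℂ) (σ : Matrix (A × C) (A × C) ℂ) (a a' : A) (p p' : C) :
    (((1 : Matrix A A ℂ) ⊗ₖ X) * σ * ((1 : Matrix A A ℂ) ⊗ₖ X)ᴴ) (a, p) (a', p') =
      ∑ q', (∑ q, X p q * σ (a, q) (a', q')) * star (X p' q') := by
  simp [Matrix.mul_apply, Fintype.sum_prod_type, Matrix.one_apply, apply_ite, ite_mul,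
    Finset.sum_ite_irrel]

/-- The operator `1 + F` on `B ⊗ B`, where `F` swaps the two factors. -/
def symmetrizer : Matrix (Fin 2 × Fin 2) (Fin 2 × Fin 2) ℂ :=
  fun p q => (if p = q then 1 else 0) + (if p = q.swap then 1 else 0)

/-- The operator `|kk⟩⟨01 - 10|` on two qubits. -/
def singletTo (k : Fin 2) : Matrix (Fin 2 × Fin 2) (Fin 2 × Fin 2) ℂ :=
  fun p q => if p = (k, k) then (if q = (0, 1) then 1 else if q = (1, 0) then -1 else 0) else 0

/-- Keep the symmetric part of `σ` and replace the singlet in its antisymmetric part by the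
uniform mixture of `|00⟩` and `|11⟩`, which has the same one-qubit marginals. -/
def bosonize {A : Type*} [Fintype A] [DecidableEq A]
    (σ : Matrix (A × Fin 2 × Fin 2) (A × Fin 2 × Fin 2) ℂ) :
    Matrix (A × Fin 2 × Fin 2) (A × Fin 2 × Fin 2) ℂ :=
  (1 / 4 : ℂ) • (((1 : Matrix A A ℂ) ⊗ₖ symmetrizer) * σ * ((1 : Matrix A A ℂ) ⊗ₖ symmetrizer)ᴴ +
    ∑ k, ((1 : Matrix A A ℂ) ⊗ₖ singletTo k) * σ * ((1 : Matrix A A ℂ) ⊗ₖ singletTo k)ᴴ)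

lemma bosonize_posSemidef {A : Type*} [Fintype A] [DecidableEq A]
    {σ : Matrix (A × Fin 2 × Fin 2) (A × Fin 2 × Fin 2) ℂ} (hσ : σ.PosSemidef) :
    (bosonize σ).PosSemidef := by
  refine Matrix.PosSemidef.smul (Matrix.PosSemidef.add (hσ.mul_mul_conjTranspose_same _) ?_) ?_
  · exact Matrix.posSemidef_sum _ fun k _ => hσ.mul_mul_conjTranspose_same _
  · positivity

lemma bosonize_apply {A : Type*} [Fintype A] [DecidableEq A]
    (σ : Matrix (A × Fin 2 × Fin 2) (A × Fin 2 × Fin 2) ℂ) (a a' : A) (b c b' c' : Fin 2) :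
    bosonize σ (a, b, c) (a', b', c') = 1 / 4 *
      (σ (a, b, c) (a', b', c') + σ (a, c, b) (a', b', c') +
        σ (a, b, c) (a', c', b') + σ (a, c, b) (a', c', b') +
        if b = c ∧ b' = c' ∧ b = b' then
          σ (a, 0, 1) (a', 0, 1) - σ (a, 0, 1) (a', 1, 0) -
            σ (a, 1, 0) (a', 0, 1) + σ (a, 1, 0) (a', 1, 0)
        else 0) := by
  simp only [bosonize, Matrix.smul_apply, Matrix.add_apply, Matrix.sum_apply,
    one_kronecker_conj_apply, smul_eq_mul]
  congr 1
  fin_cases b <;> fin_cases c <;> fin_cases b' <;> fin_cases c' <;>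
    simp [symmetrizer, singletTo, Fintype.sum_prod_type] <;> ring

/-- When `B` is a qubit, every symmetric-extendible state admits a bosonic extension. -/
theorem stmt_18 (dA : ℕ)
    (ρ : Matrix (Fin dA × Fin 2) (Fin dA × Fin 2) ℂ)
    (hρ : ρ.PosSemidef) (hρtr : ρ.trace = 1)
    (hext : ∃ σ, IsSymExt ρ σ) :
    ∃ σ : Matrix (Fin dA × Fin 2 × Fin 2) (Fin dA × Fin 2 × Fin 2) ℂ,
      IsSymExt ρ σ ∧
      (∀ a b₁ b₂ a' b₁' b₂', σ (a, b₁, b₂) (a', b₁', b₂') = σ (a, b₂, b₁) (a', b₁', b₂')) := by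
  obtain ⟨σ, hpsd, -, hmarg, hswap⟩ := hext
  have hmarg' : ∀ a a' b b', ∑ c, bosonize σ (a, b, c) (a', b', c) = ρ (a, b) (a', b') := by
    intro a a' b b'
    rw [← hmarg]
    have h1 := hswap a 0 1 a' 0 1
    have h2 := hswap a 0 1 a' 1 0
    have h3 := hswap a 0 0 a' 0 1
    have h4 := hswap a 0 1 a' 0 0
    have h5 := hswap a 1 1 a' 0 1
    have h6 := hswap a 0 1 a' 1 1
    fin_cases b <;> fin_cases b' <;> simp [bosonize_apply] <;> grind
  refine ⟨bosonize σ, ⟨bosonize_posSemidef hpsd, ?_, hmarg', ?_⟩, ?_⟩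
  · rw [← hρtr]
    simp only [Matrix.trace, Matrix.diag_apply, Fintype.sum_prod_type (γ := ℂ)]
    exact Finset.sum_congr rfl fun a _ => Finset.sum_congr rfl fun b _ => hmarg' a a b b
  · intro a b₁ b₂ a' b₁' b₂'
    simp only [bosonize_apply]
    grind
  · intro a b₁ b₂ a' b₁' b₂'
    simp only [bosonize_apply]
    grind
end
end

section
/- Let α, β, γ be nonzero complex numbers with 2(|α|² + |β|² + |γ|²) = 1, and let ψ ∈ ℂ³⊗ℂ³⊗ℂ³ (indexed by Fin 3 × Fin 3 × Fin 3) be the unit vector ψ = α(e₀₁₂ − e₀₂₁) + β(e₁₂₀ − e₁₀₂) + γ(e₂₀₁ − e₂₁₀), where e_{abc} are standard basis vectors. Let ρ be the two-qutrit state obtained from ψψᴴ by tracing out the third factor: ρ (a,b) (a',b') = ∑_c (ψψᴴ) (a,b,c) (a',b',c). Then ρ admits a symmetric extension (namely ψψᴴ itself), but ρ does not admit any bosonic extension. -/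
open Matrix Kronecker ComplexOrder

noncomputable section

/-- A kernel vector of a bipartite state, tensored with a basis vector, is annihilated by every
symmetric extension of that state. -/
theorem IsSymExt.sum_mul_eq_zero {A B : Type*} [Fintype A] [DecidableEq A] [Fintype B]
    [DecidableEq B] {ρ : Matrix (A × B) (A × B) ℂ} {σ : Matrix (A × B × B) (A × B × B) ℂ}
    (h : IsSymExt ρ σ) {w : A × B → ℂ} (hw : ρ *ᵥ w = 0) (x : A × B × B) (c : B) :
    ∑ a, ∑ b, σ x (a, b, c) * w (a, b) = 0 := by
  obtain ⟨hpos, -, hpt, -⟩ := h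
  let v : B → A × B × B → ℂ := fun c y => if y.2.2 = c then w (y.1, y.2.1) else 0
  have hmul : ∀ c y, (σ *ᵥ v c) y = ∑ a, ∑ b, σ y (a, b, c) * w (a, b) := by
    intro c y
    simp [v, mulVec, dotProduct, Fintype.sum_prod_type]
  have hsum : ∑ c, star (v c) ⬝ᵥ (σ *ᵥ v c) = star w ⬝ᵥ (ρ *ᵥ w) := by
    have hl : ∀ c, star (v c) ⬝ᵥ (σ *ᵥ v c) =
        ∑ a, ∑ b, star (w (a, b)) * ∑ a', ∑ b', σ (a, b, c) (a', b', c) * w (a', b') := by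
      intro c
      simp only [dotProduct, Fintype.sum_prod_type, hmul]
      simp [v, apply_ite (star : ℂ → ℂ)]
    rw [Finset.sum_congr rfl fun c _ => hl c]
    simp only [dotProduct, mulVec, Fintype.sum_prod_type, ← hpt, Finset.sum_mul,
      Pi.star_apply]
    rw [Finset.sum_comm]
    refine Finset.sum_congr rfl fun a _ => ?_
    rw [Finset.sum_comm]
    refine Finset.sum_congr rfl fun b _ => ?_
    rw [← Finset.mul_sum, Finset.sum_comm]
    congr 1
    refine Finset.sum_congr rfl fun a' _ => ?_
    rw [Finset.sum_comm]
  rw [hw, dotProduct_zero] at hsum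
  have hzero := (Finset.sum_eq_zero_iff_of_nonneg
    fun c _ => hpos.dotProduct_mulVec_nonneg (v c)).1 hsum c (Finset.mem_univ c)
  rw [← hmul, (hpos.dotProduct_mulVec_zero_iff (v c)).1 hzero, Pi.zero_apply]

/-- A tensor on three qutrits that is symmetric in the last two factors and whose slices are
orthogonal to the kernel vectors of the state with a fermionic extension vanishes. -/
theorem eq_zero_of_symmetric_of_orthogonal {K : Type*} [Field K] [CharZero K] {α β γ : K}
    (hα : α ≠ 0) (hβ : β ≠ 0) (hγ : γ ≠ 0) (f : Fin 3 × Fin 3 × Fin 3 → K)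
    (hsymm : ∀ a b c, f (a, b, c) = f (a, c, b)) (hdiag : ∀ a c, f (a, a, c) = 0)
    (h₀₁ : ∀ c, β * f (0, 1, c) + α * f (1, 0, c) = 0)
    (h₀₂ : ∀ c, γ * f (0, 2, c) + α * f (2, 0, c) = 0)
    (h₁₂ : ∀ c, γ * f (1, 2, c) + β * f (2, 1, c) = 0) : f = 0 := by
  have hdiag' : ∀ a b, f (a, b, a) = 0 := fun a b => (hsymm a b a).trans (hdiag a b)
  have h₂ : f (2, 0, 1) = 0 := by
    have e₁ := h₀₁ 2
    have e₂ := h₀₂ 1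
    have e₃ := h₁₂ 0
    rw [hsymm 0 2 1] at e₂
    rw [hsymm 1 2 0, hsymm 2 1 0] at e₃
    have : 2 * α * β * f (2, 0, 1) = 0 := by linear_combination β * e₂ + α * e₃ - γ * e₁
    simpa [hα, hβ] using this
  have h₀ : f (0, 1, 2) = 0 := by
    simpa [hsymm 0 2 1, h₂, hγ] using h₀₂ 1
  have h₁ : f (1, 0, 2) = 0 := by
    simpa [h₀, hα] using h₀₁ 2
  have k₁ : f (1, 0, 0) = 0 := by simpa [hdiag', hα] using h₀₁ 0
  have k₂ : f (0, 1, 1) = 0 := by simpa [hdiag', hβ] using h₀₁ 1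
  have k₃ : f (2, 0, 0) = 0 := by simpa [hdiag', hα] using h₀₂ 0
  have k₄ : f (0, 2, 2) = 0 := by simpa [hdiag', hγ] using h₀₂ 2
  have k₅ : f (2, 1, 1) = 0 := by simpa [hdiag', hβ] using h₁₂ 1
  have k₆ : f (1, 2, 2) = 0 := by simpa [hdiag', hγ] using h₁₂ 2
  funext ⟨a, b, c⟩
  fin_cases a <;> fin_cases b <;> fin_cases c <;>
    simp [hdiag, hdiag', h₀, h₁, h₂, k₁, k₂, k₃, k₄, k₅, k₆, hsymm 0 2 1, hsymm 1 2 0,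
      hsymm 2 1 0]

/-- A two-qutrit state with a fermionic (hence symmetric) extension that admits
no bosonic extension. -/
theorem stmt_19 (α β γ : ℂ)
    (hα : α ≠ 0) (hβ : β ≠ 0) (hγ : γ ≠ 0)
    (hnorm : 2 * (Complex.normSq α + Complex.normSq β + Complex.normSq γ) = 1)
    (ψ : (Fin 3 × Fin 3 × Fin 3) → ℂ)
    (hψ : ψ = fun x =>
      α * ((if x = (0, 1, 2) then 1 else 0) - (if x = (0, 2, 1) then 1 else 0)) +
      β * ((if x = (1, 2, 0) then 1 else 0) - (if x = (1, 0, 2) then 1 else 0)) +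
      γ * ((if x = (2, 0, 1) then 1 else 0) - (if x = (2, 1, 0) then 1 else 0)))
    (ρ : Matrix (Fin 3 × Fin 3) (Fin 3 × Fin 3) ℂ)
    (hρdef : ρ = fun p q => ∑ c, vecMulVec ψ (star ψ) (p.1, p.2, c) (q.1, q.2, c)) :
    IsSymExt ρ (vecMulVec ψ (star ψ)) ∧
    ¬ ∃ σ : Matrix (Fin 3 × Fin 3 × Fin 3) (Fin 3 × Fin 3 × Fin 3) ℂ,
        IsSymExt ρ σ ∧
        (∀ a b₁ b₂ a' b₁' b₂',
          σ (a, b₁, b₂) (a', b₁', b₂') = σ (a, b₂, b₁) (a', b₁', b₂')) := by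
  have hψ_swap : ∀ a b c, ψ (a, b, c) = -ψ (a, c, b) := by
    intro a b c
    subst hψ
    fin_cases a <;> fin_cases b <;> fin_cases c <;> simp
  refine ⟨⟨posSemidef_vecMulVec_self_star ψ, ?_, ?_, ?_⟩, ?_⟩
  · have hnorm' : 2 * (α * star α + β * star β + γ * star γ) = 1 := by
      simp only [Complex.star_def, Complex.mul_conj]
      exact_mod_cast hnorm
    rw [trace_vecMulVec, ← hnorm', hψ]
    simp [dotProduct, Fintype.sum_prod_type, Fin.sum_univ_three]
    ring
  · intro a a' b b'
    rw [hρdef]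
  · intro a b₁ b₂ a' b₁' b₂'
    simp only [vecMulVec_apply, Pi.star_apply]
    rw [hψ_swap a b₁ b₂, hψ_swap a' b₁' b₂', star_neg, neg_mul_neg]
  · rintro ⟨σ, hσ, hbos⟩
    have hker : ∀ w : Fin 3 × Fin 3 → ℂ,
        (∀ c, ∑ a, ∑ b, star (ψ (a, b, c)) * w (a, b) = 0) → ρ *ᵥ w = 0 := by
      intro w hw
      have hρ : ρ = ∑ c, vecMulVec (fun p => ψ (p.1, p.2, c)) (star fun p => ψ (p.1, p.2, c)) := by
        ext p q
        simp [hρdef, Matrix.sum_apply, vecMulVec_apply]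
      rw [hρ, Matrix.sum_mulVec]
      refine Finset.sum_eq_zero fun c _ => ?_
      rw [vecMulVec_mulVec]
      have : (star fun p : Fin 3 × Fin 3 => ψ (p.1, p.2, c)) ⬝ᵥ w = 0 := by
        simpa [dotProduct, Fintype.sum_prod_type] using hw c
      simp [this]
    have hpair : ∀ (p q : Fin 3 × Fin 3) (s t : ℂ),
        (∀ c, star (ψ (p.1, p.2, c)) * s + star (ψ (q.1, q.2, c)) * t = 0) →
        ∀ x c, s * σ x (p.1, p.2, c) + t * σ x (q.1, q.2, c) = 0 := by
      intro p q s t h x c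
      have key := hσ.sum_mul_eq_zero (w := Pi.single p s + Pi.single q t)
        (hker _ fun c => ?_) x c
      · rw [← Fintype.sum_prod_type' (f := fun a b => σ x (a, b, c) * _)] at key
        simpa [mul_add, Finset.sum_add_distrib, Pi.single_apply, mul_comm s, mul_comm t] using key
      · rw [← Fintype.sum_prod_type' (f := fun a b => star (ψ (a, b, c)) * _)]
        simpa [mul_add, Finset.sum_add_distrib, Pi.single_apply] using h c
    have hzero : σ = 0 := by
      ext ⟨a, b, c⟩ y
      refine congrFun (eq_zero_of_symmetric_of_orthogonal (star_ne_zero.2 hα) (star_ne_zero.2 hβ)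
        (star_ne_zero.2 hγ) (σ (a, b, c)) ?_ ?_ ?_ ?_ ?_) y
      · intro a' b' c'
        rw [hσ.2.2.2, ← hbos]
      · intro a' c'
        simpa using hpair (a', a') (a', a') 1 0 (fun c => by
          subst hψ; fin_cases a' <;> fin_cases c <;> simp) (a, b, c) c'
      · exact hpair (0, 1) (1, 0) _ _ (fun c => by
          subst hψ; fin_cases c <;> simp [mul_comm]) (a, b, c)
      · exact hpair (0, 2) (2, 0) _ _ (fun c => by
          subst hψ; fin_cases c <;> simp [mul_comm]) (a, b, c)
      · exact hpair (1, 2) (2, 1) _ _ (fun c => by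
          subst hψ; fin_cases c <;> simp [mul_comm]) (a, b, c)
    have htr := hσ.2.1
    simp [hzero] at htr
end
end
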